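/- Let n be a positive integer that is not a perfect square and let Q = [a,b,c] be an integral binary quadratic form of discriminant 4n and content k, so that d' := 4n/k² is the discriminant of the primitive form Q/k (a positive nonsquare discriminant). Then, as T → ∞, D_T^Q = 6·T·log(λ_{d'})/(π²·n^{1/2}) + o(T). -/

import Mathlib

open Filter Real Asymptotics

/-- The substitution action of `SL₂(ℤ)` on integral binary quadratic forms, where a form
`a x² + b x y + c y²` is encoded as the triple `(a, b, c)`: for `g = (p q; r s)` the form
`g • Q` is `(x, y) ↦ Q (p x + q y, r x + s y)`. -/
def actForm (g : Matrix.SpecialLinearGroup (Fin 2) ℤ) (Q : ℤ × ℤ × ℤ) : ℤ × ℤ × ℤ :=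
  let p := (g : Matrix (Fin 2) (Fin 2) ℤ) 0 0
  let q := (g : Matrix (Fin 2) (Fin 2) ℤ) 0 1
  let r := (g : Matrix (Fin 2) (Fin 2) ℤ) 1 0
  let s := (g : Matrix (Fin 2) (Fin 2) ℤ) 1 1
  (Q.1 * p ^ 2 + Q.2.1 * p * r + Q.2.2 * r ^ 2,
   2 * Q.1 * p * q + Q.2.1 * (p * s + q * r) + 2 * Q.2.2 * r * s,
   Q.1 * q ^ 2 + Q.2.1 * q * s + Q.2.2 * s ^ 2)

/-- Proper (`SL₂(ℤ)`) equivalence of integral binary quadratic forms. -/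
def ProperEquiv (Q Q' : ℤ × ℤ × ℤ) : Prop := ∃ g, actForm g Q = Q'

/-- `DTQ n Q T` is the number of `D(n)`-pairs `{a, c}` (written with `a > c`) with
`a, c ∈ {-T, …, T}` whose associated form `E_{ac} = [a, 2√(ac+n), c]` is properly
equivalent to `Q`. -/
noncomputable def DTQ (n : ℤ) (Q : ℤ × ℤ × ℤ) (T : ℝ) : ℕ :=
  Set.ncard {ac : ℤ × ℤ | ac.2 < ac.1 ∧ ac.1 ≠ 0 ∧ ac.2 ≠ 0 ∧
    |(ac.1 : ℝ)| ≤ T ∧ |(ac.2 : ℝ)| ≤ T ∧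
    ∃ b : ℤ, 0 ≤ b ∧ b ^ 2 = ac.1 * ac.2 + n ∧ ProperEquiv (ac.1, 2 * b, ac.2) Q}

/-- `FTQ Q T` is the number of integral binary quadratic forms `[a, b, c]` with
`|a| ≤ T`, `|c| ≤ T`, `a > c`, `b ≥ 0` which are properly equivalent to `Q`. -/
noncomputable def FTQ (Q : ℤ × ℤ × ℤ) (T : ℝ) : ℕ :=
  Set.ncard {f : ℤ × ℤ × ℤ | |(f.1 : ℝ)| ≤ T ∧ |(f.2.2 : ℝ)| ≤ T ∧
    f.2.2 < f.1 ∧ 0 ≤ f.2.1 ∧ ProperEquiv f Q}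

/-- `ω(d)`: the number of `SL₂(ℤ)`-automorphs of a primitive definite form of
discriminant `d`. -/
def omegaDisc (d : ℤ) : ℕ := if d = -4 then 4 else if d = -3 then 6 else 2

/-- The sector `1 ≤ z₀ / z₁ < l²` of the positive quadrant, cut off by the hyperbola `z₀ z₁ = 1`. -/
def hypSector (l : ℝ) : Set (Fin 2 → ℝ) :=
  {z | 0 < z 1 ∧ z 1 ≤ z 0 ∧ z 0 < l ^ 2 * z 1 ∧ z 0 * z 1 ≤ 1}

lemma measurableSet_hypSector (l : ℝ) : MeasurableSet (hypSector l) := by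
  have h0 : Measurable fun z : Fin 2 → ℝ => z 0 := measurable_pi_apply 0
  have h1 : Measurable fun z : Fin 2 → ℝ => z 1 := measurable_pi_apply 1
  exact (measurableSet_lt measurable_const h1).inter <| (measurableSet_le h1 h0).inter <|
    (measurableSet_lt h0 (h1.const_mul _)).inter (measurableSet_le (h0.mul h1) measurable_const)

lemma isBounded_hypSector (l : ℝ) : Bornology.IsBounded (hypSector l) := by
  refine (Metric.isBounded_closedBall (x := (0 : Fin 2 → ℝ)) (r := l ^ 2 + 1)).subset ?_
  rintro z ⟨h1, h2, h3, h4⟩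
  have hz1 : z 1 ≤ 1 := by nlinarith
  have hl : 0 ≤ l ^ 2 := sq_nonneg l
  have hz0 : z 0 ≤ l ^ 2 + 1 := by nlinarith
  rw [mem_closedBall_zero_iff, pi_norm_le_iff_of_nonneg (by positivity)]
  intro i
  fin_cases i
  · simpa [abs_of_pos (h1.trans_le h2)] using hz0
  · simp only [Fin.mk_one, Real.norm_eq_abs, abs_of_pos h1]
    linarith

lemma convex_hyperbola :
    Convex ℝ {z : Fin 2 → ℝ | 0 < z 0 ∧ 1 < z 0 * z 1} := by
  rintro x ⟨hx, hx'⟩ y ⟨hy, hy'⟩ s t hs ht hst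
  have hx1 : 0 < x 1 := pos_of_mul_pos_right (one_pos.trans hx') hx.le
  have hy1 : 0 < y 1 := pos_of_mul_pos_right (one_pos.trans hy') hy.le
  have hcross : 2 < x 0 * y 1 + y 0 * x 1 := by
    have h : 1 < (x 0 * y 1) * (y 0 * x 1) := by nlinarith [mul_pos hx hx1, mul_pos hy hy1]
    have h' : 0 < x 0 * y 1 := mul_pos hx hy1
    have h'' : 0 < y 0 * x 1 := mul_pos hy hx1
    nlinarith [sq_nonneg (x 0 * y 1 - y 0 * x 1)]
  simp only [Set.mem_ofPred_eq, Pi.add_apply, Pi.smul_apply, smul_eq_mul]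
  rcases hs.eq_or_lt with rfl | hs
  · obtain rfl : t = 1 := by linarith
    simpa using ⟨hy, hy'⟩
  refine ⟨by positivity, ?_⟩
  have h1 : s ^ 2 < s ^ 2 * (x 0 * x 1) := by nlinarith [pow_pos hs 2]
  have h2 : t ^ 2 ≤ t ^ 2 * (y 0 * y 1) := by nlinarith [sq_nonneg t]
  have h3 : s * t * 2 ≤ s * t * (x 0 * y 1 + y 0 * x 1) := by
    nlinarith [mul_nonneg hs.le ht]
  have h4 : (s + t) ^ 2 = 1 := by rw [hst]; norm_num
  nlinarith

lemma volume_frontier_hypSector (l : ℝ) : MeasureTheory.volume (frontier (hypSector l)) = 0 := by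
  have hC : Convex ℝ {z : Fin 2 → ℝ | 0 < z 1 ∧ z 1 ≤ z 0 ∧ z 0 < l ^ 2 * z 1} := by
    rintro x ⟨hx1, hx2, hx3⟩ y ⟨hy1, hy2, hy3⟩ s t hs ht hst
    simp only [Set.mem_ofPred_eq, Pi.add_apply, Pi.smul_apply, smul_eq_mul]
    rcases hs.eq_or_lt with rfl | hs
    · obtain rfl : t = 1 := by linarith
      simpa using ⟨hy1, hy2, hy3⟩
    · refine ⟨by positivity, by gcongr, ?_⟩
      nlinarith
  have heq : hypSector l = {z : Fin 2 → ℝ | 0 < z 1 ∧ z 1 ≤ z 0 ∧ z 0 < l ^ 2 * z 1} ∩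
      {z : Fin 2 → ℝ | 0 < z 0 ∧ 1 < z 0 * z 1}ᶜ := by
    ext z
    simp only [hypSector, Set.mem_ofPred_eq, Set.mem_inter_iff, Set.mem_compl_iff, not_and, not_lt]
    constructor
    · rintro ⟨h1, h2, h3, h4⟩
      exact ⟨⟨h1, h2, h3⟩, fun _ => h4⟩
    · rintro ⟨⟨h1, h2, h3⟩, h4⟩
      exact ⟨h1, h2, h3, h4 (h1.trans_le h2)⟩
  rw [heq]
  refine MeasureTheory.measure_mono_null (t := frontier _ ∪ frontier _)
    ((frontier_inter_subset _ _).trans (Set.union_subset_union Set.inter_subset_left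
      Set.inter_subset_right)) ?_
  rw [frontier_compl]
  exact MeasureTheory.measure_union_null (hC.addHaar_frontier _)
    (convex_hyperbola.addHaar_frontier _)

lemma hasIntegral_min_inv_sub {l : ℝ} (hl : 1 < l) :
    IntervalIntegrable (fun x : ℝ => min x x⁻¹ - x / l ^ 2) MeasureTheory.volume 0 l ∧
      ∫ x in (0 : ℝ)..l, (min x x⁻¹ - x / l ^ 2) = Real.log l := by
  have hl0 : 0 < l := one_pos.trans hl
  have e1 : Set.EqOn (fun x : ℝ => min x x⁻¹ - x / l ^ 2) (fun x => x - x / l ^ 2)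
      (Set.uIcc 0 1) := by
    intro x hx
    rw [Set.uIcc_of_le zero_le_one] at hx
    have : x ≤ x⁻¹ := by
      rcases hx.1.eq_or_lt with rfl | h
      · simp
      · exact hx.2.trans ((one_le_inv₀ h).2 hx.2)
    simp [min_eq_left this]
  have e2 : Set.EqOn (fun x : ℝ => min x x⁻¹ - x / l ^ 2) (fun x => x⁻¹ - x / l ^ 2)
      (Set.uIcc 1 l) := by
    intro x hx
    rw [Set.uIcc_of_le hl.le] at hx
    have : x⁻¹ ≤ x := (inv_le_one_of_one_le₀ hx.1).trans hx.1
    simp [min_eq_right this]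
  have i3 : IntervalIntegrable (fun x : ℝ => x⁻¹) MeasureTheory.volume 1 l :=
    intervalIntegral.intervalIntegrable_inv (fun x hx => by
      rw [Set.uIcc_of_le hl.le] at hx; linarith [hx.1]) continuousOn_id
  have i4 (u v : ℝ) : IntervalIntegrable (fun x : ℝ => x / l ^ 2) MeasureTheory.volume u v :=
    (by fun_prop : Continuous fun x : ℝ => x / l ^ 2).intervalIntegrable _ _
  have j1 := (intervalIntegral.intervalIntegrable_id.sub (i4 0 1)).congr
    (e1.symm.mono Set.uIoc_subset_uIcc)
  have j2 := (i3.sub (i4 1 l)).congr (e2.symm.mono Set.uIoc_subset_uIcc)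
  refine ⟨j1.trans j2, ?_⟩
  rw [← intervalIntegral.integral_add_adjacent_intervals j1 j2,
    intervalIntegral.integral_congr e1, intervalIntegral.integral_congr e2,
    intervalIntegral.integral_sub i3 (i4 1 l),
    intervalIntegral.integral_sub intervalIntegral.intervalIntegrable_id (i4 0 1),
    integral_inv_of_pos one_pos hl0]
  simp only [intervalIntegral.integral_div, integral_id]
  field_simp
  ring

lemma volume_hypSector {l : ℝ} (hl : 1 < l) :
    MeasureTheory.volume (hypSector l) = ENNReal.ofReal (Real.log l) := by
  have hl0 : 0 < l := one_pos.trans hl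
  set S : Set (ℝ × ℝ) := {z | 0 < z.2 ∧ z.2 ≤ z.1 ∧ z.1 < l ^ 2 * z.2 ∧ z.1 * z.2 ≤ 1} with hS
  have hSm : MeasurableSet S :=
    (measurableSet_lt measurable_const measurable_snd).inter <|
      (measurableSet_le measurable_snd measurable_fst).inter <|
      (measurableSet_lt measurable_fst (measurable_snd.const_mul _)).inter
        (measurableSet_le (measurable_fst.mul measurable_snd) measurable_const)
  have h1 : hypSector l = MeasurableEquiv.finTwoArrow ⁻¹' S := rfl
  rw [h1, (MeasureTheory.volume_preserving_finTwoArrow ℝ).measure_preimage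
    hSm.nullMeasurableSet, MeasureTheory.Measure.volume_eq_prod,
    MeasureTheory.Measure.prod_apply hSm]
  have hslice : ∀ x : ℝ, MeasureTheory.volume (Prod.mk x ⁻¹' S) =
      (Set.Ioc 0 l).indicator (fun x => ENNReal.ofReal (min x x⁻¹ - x / l ^ 2)) x := by
    intro x
    by_cases hx : x ∈ Set.Ioc 0 l
    · rw [Set.indicator_of_mem hx, ← Real.volume_Ioc]
      congr 1
      ext y
      have hx0 := hx.1
      have e1 : x / l ^ 2 < y ↔ x < l ^ 2 * y := by rw [div_lt_iff₀ (by positivity), mul_comm]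
      have e2 : y ≤ x⁻¹ ↔ x * y ≤ 1 := by rw [← one_div, le_div_iff₀ hx0, mul_comm]
      simp only [hS, Set.mem_preimage, Set.mem_ofPred_eq, Set.mem_Ioc, le_min_iff, e1, e2]
      refine ⟨fun h => ⟨h.2.2.1, h.2.1, h.2.2.2⟩, fun h => ⟨?_, h.2.1, h.1, h.2.2⟩⟩
      exact pos_of_mul_pos_right (hx0.trans h.1) (sq_nonneg l)
    · rw [Set.indicator_of_notMem hx]
      convert MeasureTheory.measure_empty (μ := MeasureTheory.volume)
      refine Set.eq_empty_of_forall_notMem fun y hy => hx ?_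
      obtain ⟨h1, h2, h3, h4⟩ : 0 < y ∧ y ≤ x ∧ x < l ^ 2 * y ∧ x * y ≤ 1 := hy
      refine ⟨h1.trans_le h2, le_of_not_gt fun h => ?_⟩
      nlinarith [mul_pos hl0 hl0]
  have hnn : ∀ x ∈ Set.Ioc 0 l, 0 ≤ min x x⁻¹ - x / l ^ 2 := by
    rintro x ⟨hx0, hxl⟩
    rw [sub_nonneg, le_min_iff, div_le_iff₀ (by positivity), div_le_iff₀ (by positivity),
      inv_mul_eq_div, le_div_iff₀ hx0]
    exact ⟨le_mul_of_one_le_right hx0.le (one_le_pow₀ hl.le), by nlinarith⟩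
  obtain ⟨hint, hval⟩ := hasIntegral_min_inv_sub hl
  simp_rw [hslice]
  rw [MeasureTheory.lintegral_indicator measurableSet_Ioc,
    ← MeasureTheory.ofReal_integral_eq_lintegral_ofReal hint.1
      ((MeasureTheory.ae_restrict_iff' measurableSet_Ioc).2 (Eventually.of_forall hnn)),
    ← intervalIntegral.integral_of_le hl0.le, hval]

open scoped Pointwise in
lemma tendsto_card_preimage_hypSector {l : ℝ} (hl : 1 < l)
    (f : (Fin 2 → ℝ) →ₗ[ℝ] (Fin 2 → ℝ)) (hf : LinearMap.det f ≠ 0) :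
    Tendsto (fun x : ℝ => (Nat.card ↑((f ⁻¹' hypSector l) ∩
      x⁻¹ • (Submodule.span ℤ (Set.range (Pi.basisFun ℝ (Fin 2))) : Set (Fin 2 → ℝ))) : ℝ) / x ^ 2)
      atTop (nhds (|LinearMap.det f|⁻¹ * Real.log l)) := by
  set e := (f.equivOfDetNeZero hf).toContinuousLinearEquiv with he
  have hef : (e : (Fin 2 → ℝ) → (Fin 2 → ℝ)) = f := rfl
  have hlog : 0 ≤ Real.log l := Real.log_nonneg hl.le
  have hvol : MeasureTheory.volume.real (f ⁻¹' hypSector l) =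
      |LinearMap.det f|⁻¹ * Real.log l := by
    rw [MeasureTheory.measureReal_def, MeasureTheory.Measure.addHaar_preimage_linearMap _ hf,
      volume_hypSector hl, ← ENNReal.ofReal_mul (abs_nonneg _),
      ENNReal.toReal_ofReal (by positivity), abs_inv]
  rw [← hvol]
  refine tendsto_card_div_pow_atTop_volume' _ ?_ ?_ ?_ ?_
  · rw [← hef, ← e.image_symm_eq_preimage]
    exact e.symm.toContinuousLinearMap.lipschitz.isBounded_image (isBounded_hypSector l)
  · rw [← hef]
    exact e.continuous.measurable (measurableSet_hypSector l)
  · have h : frontier (f ⁻¹' hypSector l) = f ⁻¹' frontier (hypSector l) :=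
      (e.toHomeomorph.preimage_frontier _).symm
    rw [h, MeasureTheory.Measure.addHaar_preimage_linearMap _ hf, volume_frontier_hypSector,
      mul_zero]
  · rintro x y hx hxy _ ⟨z, ⟨h1, h2, h3, h4⟩, rfl⟩
    have hy : 0 < y := hx.trans_le hxy
    have hr : x / y ≤ 1 := (div_le_one hy).2 hxy
    have hr0 : 0 < x / y := div_pos hx hy
    refine ⟨(x / y) • z, ?_, ?_⟩
    · simp only [Set.mem_preimage, map_smul, hypSector, Set.mem_ofPred_eq, Pi.smul_apply,
        smul_eq_mul]
      refine ⟨by positivity, by gcongr, by nlinarith, ?_⟩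
      have : x / y * f z 0 * (x / y * f z 1) = (x / y) ^ 2 * (f z 0 * f z 1) := by ring
      rw [this]
      exact mul_le_one₀ (pow_le_one₀ hr0.le hr) (mul_pos (h1.trans_le h2) h1).le h4
    · simp only [smul_smul, mul_div_cancel₀ _ hy.ne']

lemma tsum_moebius_div_sq :
    ∑' d : ℕ, (ArithmeticFunction.moebius d : ℝ) / (d : ℝ) ^ 2 = 6 / Real.pi ^ 2 := by
  have h2 : (1 : ℝ) < (2 : ℂ).re := by norm_num
  have h := ArithmeticFunction.LSeries_zeta_mul_Lseries_moebius h2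
  rw [ArithmeticFunction.LSeries_zeta_eq_riemannZeta h2, riemannZeta_two] at h
  have h3 : LSeries (fun n => ((ArithmeticFunction.moebius n : ℤ) : ℂ)) 2 =
      ((∑' d : ℕ, (ArithmeticFunction.moebius d : ℝ) / (d : ℝ) ^ 2 : ℝ) : ℂ) := by
    rw [LSeries, Complex.ofReal_tsum]
    refine tsum_congr fun n => ?_
    rcases eq_or_ne n 0 with rfl | hn
    · simp
    · rw [LSeries.term_of_ne_zero hn]
      push_cast
      norm_cast
  rw [h3] at h
  have h4 : Real.pi ^ 2 / 6 *
      ∑' d : ℕ, (ArithmeticFunction.moebius d : ℝ) / (d : ℝ) ^ 2 = 1 := by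
    exact_mod_cast h
  have hpi := Real.pi_ne_zero
  field_simp at h4 ⊢
  linarith

lemma sum_moebius_ite_dvd {g M : ℕ} (hg : g ≠ 0) (hM : g ≤ M) :
    ∑ d ∈ Finset.Icc 1 M, (if d ∣ g then (ArithmeticFunction.moebius d : ℤ) else 0) =
      if g = 1 then 1 else 0 := by
  rw [← Finset.sum_filter]
  have : (Finset.Icc 1 M).filter (· ∣ g) = g.divisors := by
    ext d
    simp only [Finset.mem_filter, Finset.mem_Icc, Nat.mem_divisors]
    refine ⟨fun h => ⟨h.2, hg⟩, fun h => ⟨⟨Nat.pos_of_dvd_of_pos h.1 (Nat.pos_of_ne_zero hg),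
      (Nat.le_of_dvd (Nat.pos_of_ne_zero hg) h.1).trans hM⟩, h.1⟩⟩
  rw [this, ← ArithmeticFunction.coe_mul_zeta_apply, ArithmeticFunction.moebius_mul_coe_zeta,
    ArithmeticFunction.one_apply]

/-- Counting function of the points of a set `D` of integer vectors on which `q ≤ T`. -/
noncomputable def coneCount (D : Set (ℤ × ℤ)) (q : ℤ × ℤ → ℤ) (T : ℝ) : ℕ :=
  {u | u ∈ D ∧ (q u : ℝ) ≤ T}.ncard

section Primitive

variable {D : Set (ℤ × ℤ)} {q : ℤ × ℤ → ℤ}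

lemma coneCount_eq_zero (hpos : ∀ u ∈ D, 1 ≤ q u) {T : ℝ} (hT : T < 1) :
    coneCount D q T = 0 := by
  have : {u | u ∈ D ∧ (q u : ℝ) ≤ T} = ∅ := by
    refine Set.eq_empty_of_forall_notMem fun u ⟨h1, h2⟩ => ?_
    have : (1 : ℝ) ≤ q u := by exact_mod_cast hpos u h1
    linarith
  rw [coneCount, this, Set.ncard_empty]

lemma coneCount_primitive_eq_sum (hD : ∀ (d : ℤ) (u : ℤ × ℤ), 0 < d → (d • u ∈ D ↔ u ∈ D))
    (hq : ∀ (d : ℤ) (u : ℤ × ℤ), q (d • u) = d ^ 2 * q u) (hpos : ∀ u ∈ D, 1 ≤ q u)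
    (hfin : ∀ T : ℝ, {u | u ∈ D ∧ (q u : ℝ) ≤ T}.Finite) {T : ℝ} {M : ℕ} (hM : T ≤ M) :
    (coneCount {u | u ∈ D ∧ Int.gcd u.1 u.2 = 1} q T : ℤ) =
      ∑ d ∈ Finset.Icc 1 M, ArithmeticFunction.moebius d * (coneCount D q (T / (d : ℝ) ^ 2) : ℤ) := by
  classical
  have hgcd : ∀ u ∈ (hfin T).toFinset, Int.gcd u.1 u.2 ≠ 0 ∧ Int.gcd u.1 u.2 ≤ M := by
    intro u hu
    obtain ⟨h1, h2⟩ : u ∈ D ∧ (q u : ℝ) ≤ T := by simpa using hu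
    have hg0 : Int.gcd u.1 u.2 ≠ 0 := by
      intro h
      rw [Int.gcd_eq_zero_iff] at h
      have hu0 : u = (2 : ℤ) • u := by ext <;> simp [h.1, h.2]
      have := hq 2 u
      rw [← hu0] at this
      have := hpos u h1
      linarith
    refine ⟨hg0, ?_⟩
    obtain ⟨x, hx⟩ := Int.gcd_dvd_left u.1 u.2
    obtain ⟨y, hy⟩ := Int.gcd_dvd_right u.1 u.2
    set g := Int.gcd u.1 u.2
    have hg : (0 : ℤ) < g := by positivity
    have hu0 : u = (g : ℤ) • ((x, y) : ℤ × ℤ) := by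
      ext
      · simpa using hx
      · simpa using hy
    have h3 : (x, y) ∈ D := by rwa [← hD g _ hg, ← hu0]
    have h4 : q u = (g : ℤ) ^ 2 * q (x, y) := by rw [← hq, ← hu0]
    have h5 : (g : ℤ) ≤ q u := by
      rw [h4]
      nlinarith [hpos _ h3]
    have h6 : (g : ℝ) ≤ q u := by exact_mod_cast h5
    exact_mod_cast h6.trans (h2.trans hM)
  have hleft : coneCount {u | u ∈ D ∧ Int.gcd u.1 u.2 = 1} q T =
      ((hfin T).toFinset.filter fun u => Int.gcd u.1 u.2 = 1).card := by
    rw [coneCount, ← Set.ncard_coe_finset]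
    congr 1
    ext u
    simp [and_right_comm]
  have hright : ∀ d ∈ Finset.Icc 1 M, coneCount D q (T / (d : ℝ) ^ 2) =
      ((hfin T).toFinset.filter fun u => d ∣ Int.gcd u.1 u.2).card := by
    intro d hd
    have hd0 : 0 < d := (Finset.mem_Icc.1 hd).1
    have hdz : (0 : ℤ) < d := by exact_mod_cast hd0
    have hdr : (0 : ℝ) < d := by exact_mod_cast hd0
    rw [coneCount, ← Set.ncard_coe_finset]
    have key : ((hfin T).toFinset.filter fun u => d ∣ Int.gcd u.1 u.2 : Set (ℤ × ℤ)) =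
        (fun u : ℤ × ℤ => (d : ℤ) • u) '' {u | u ∈ D ∧ (q u : ℝ) ≤ T / (d : ℝ) ^ 2} := by
      ext u
      simp only [Finset.coe_filter, Set.Finite.mem_toFinset, Set.mem_ofPred_eq, Set.mem_image]
      have hle : ∀ v, ((q ((d : ℤ) • v) : ℤ) : ℝ) ≤ T ↔ (q v : ℝ) ≤ T / (d : ℝ) ^ 2 := by
        intro v
        rw [hq, le_div_iff₀ (by positivity), mul_comm]
        push_cast
        rfl
      constructor
      · rintro ⟨⟨h1, h2⟩, h3⟩
        obtain ⟨x, hx⟩ := (Int.natCast_dvd_natCast.2 h3).trans (Int.gcd_dvd_left u.1 u.2)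
        obtain ⟨y, hy⟩ := (Int.natCast_dvd_natCast.2 h3).trans (Int.gcd_dvd_right u.1 u.2)
        have hu0 : (d : ℤ) • ((x, y) : ℤ × ℤ) = u := by
          ext
          · simpa using hx.symm
          · simpa using hy.symm
        refine ⟨(x, y), ⟨?_, ?_⟩, hu0⟩
        · rwa [← hD d _ hdz, hu0]
        · rwa [← hle, hu0]
      · rintro ⟨v, ⟨h1, h2⟩, rfl⟩
        refine ⟨⟨(hD d v hdz).2 h1, (hle v).2 h2⟩, ?_⟩
        exact Int.dvd_gcd (Dvd.intro _ rfl) (Dvd.intro _ rfl)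
    rw [key, Set.ncard_image_of_injective]
    exact smul_right_injective _ hdz.ne'
  rw [hleft, Finset.sum_congr rfl fun d hd => by rw [hright d hd]]
  simp only [Finset.card_filter, Nat.cast_sum, Finset.mul_sum]
  rw [Finset.sum_comm]
  refine Finset.sum_congr rfl fun u hu => ?_
  have := sum_moebius_ite_dvd (hgcd u hu).1 (hgcd u hu).2
  simpa using this.symm

lemma tendsto_coneCount_primitive
    (hD : ∀ (d : ℤ) (u : ℤ × ℤ), 0 < d → (d • u ∈ D ↔ u ∈ D))
    (hq : ∀ (d : ℤ) (u : ℤ × ℤ), q (d • u) = d ^ 2 * q u) (hpos : ∀ u ∈ D, 1 ≤ q u)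
    (hfin : ∀ T : ℝ, {u | u ∈ D ∧ (q u : ℝ) ≤ T}.Finite) {α : ℝ}
    (hα : Tendsto (fun T : ℝ => (coneCount D q T : ℝ) / T) atTop (nhds α)) :
    Tendsto (fun T : ℝ => (coneCount {u | u ∈ D ∧ Int.gcd u.1 u.2 = 1} q T : ℝ) / T) atTop
      (nhds (6 / Real.pi ^ 2 * α)) := by
  have hmono : Monotone (coneCount D q) := fun S T h =>
    Set.ncard_le_ncard (fun u hu => ⟨hu.1, hu.2.trans h⟩) (hfin T)
  obtain ⟨C, hC0, hC⟩ : ∃ C : ℝ, 0 ≤ C ∧ ∀ T : ℝ, 0 < T → (coneCount D q T : ℝ) ≤ C * T := by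
    obtain ⟨T₀, hT₀⟩ := eventually_atTop.1 (hα.eventually (gt_mem_nhds (lt_add_one α)))
    refine ⟨max (coneCount D q T₀) (α + 1), (Nat.cast_nonneg _).trans (le_max_left _ _),
      fun T hT => ?_⟩
    rcases lt_or_ge T 1 with h1 | h1
    · rw [coneCount_eq_zero hpos h1]
      have : (0 : ℝ) ≤ max (coneCount D q T₀ : ℝ) (α + 1) :=
        (Nat.cast_nonneg _).trans (le_max_left _ _)
      simpa using mul_nonneg this hT.le
    rcases le_total T T₀ with h2 | h2
    · have h3 : (coneCount D q T : ℝ) ≤ coneCount D q T₀ := by exact_mod_cast hmono h2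
      have h4 : (coneCount D q T₀ : ℝ) ≤ max (coneCount D q T₀ : ℝ) (α + 1) := le_max_left _ _
      nlinarith [(Nat.cast_nonneg (coneCount D q T₀) : (0 : ℝ) ≤ _)]
    · have h3 := (div_lt_iff₀ hT).1 (hT₀ T h2)
      have h4 : α + 1 ≤ max (coneCount D q T₀ : ℝ) (α + 1) := le_max_right _ _
      nlinarith
  have hsum : ∀ T : ℝ, (coneCount {u | u ∈ D ∧ Int.gcd u.1 u.2 = 1} q T : ℝ) / T =
      ∑' d : ℕ, (ArithmeticFunction.moebius d : ℝ) * (coneCount D q (T / (d : ℝ) ^ 2)) / T := by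
    intro T
    have h := coneCount_primitive_eq_sum hD hq hpos hfin (Nat.le_ceil T)
    have h' : (coneCount {u | u ∈ D ∧ Int.gcd u.1 u.2 = 1} q T : ℝ) =
        ∑ d ∈ Finset.Icc 1 ⌈T⌉₊,
          (ArithmeticFunction.moebius d : ℝ) * (coneCount D q (T / (d : ℝ) ^ 2)) := by
      exact_mod_cast h
    rw [h', Finset.sum_div, tsum_eq_sum]
    intro d hd
    rcases Nat.eq_zero_or_pos d with rfl | hd0
    · simp
    have hlt : ⌈T⌉₊ < d := by simpa [Nat.one_le_iff_ne_zero.2 hd0.ne'] using hd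
    have h1 : T < d := Nat.lt_of_ceil_lt hlt
    have h2 : (1 : ℝ) ≤ d := by exact_mod_cast hd0
    rw [coneCount_eq_zero hpos]
    · simp
    · rw [div_lt_one (by positivity)]
      nlinarith
  simp_rw [hsum]
  have hlim : 6 / Real.pi ^ 2 * α =
      ∑' d : ℕ, (ArithmeticFunction.moebius d : ℝ) / (d : ℝ) ^ 2 * α := by
    rw [tsum_mul_right, tsum_moebius_div_sq]
  rw [hlim]
  refine tendsto_tsum_of_dominated_convergence (bound := fun d : ℕ => C * (1 / (d : ℝ) ^ 2))
    ((Real.summable_one_div_nat_pow.2 one_lt_two).mul_left C) ?_ ?_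
  · intro d
    rcases Nat.eq_zero_or_pos d with rfl | hd0
    · simp
    have hdr : (0 : ℝ) < d := by exact_mod_cast hd0
    have h1 : Tendsto (fun T : ℝ => T / (d : ℝ) ^ 2) atTop atTop :=
      tendsto_id.atTop_div_const (by positivity)
    refine ((hα.comp h1).const_mul _).congr fun T => ?_
    simp only [Function.comp]
    field_simp
  · filter_upwards [eventually_gt_atTop 0] with T hT d
    rcases Nat.eq_zero_or_pos d with rfl | hd0
    · simp
    have hdr : (0 : ℝ) < d := by exact_mod_cast hd0
    have hμ : |(ArithmeticFunction.moebius d : ℝ)| ≤ 1 := by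
      exact_mod_cast ArithmeticFunction.abs_moebius_le_one (n := d)
    rw [Real.norm_eq_abs, abs_div, abs_mul, abs_of_pos hT, Nat.abs_cast, div_le_iff₀ hT]
    have h2 := hC (T / (d : ℝ) ^ 2) (by positivity)
    calc _ ≤ 1 * (coneCount D q (T / (d : ℝ) ^ 2) : ℝ) := by gcongr
      _ ≤ C * (T / (d : ℝ) ^ 2) := by simpa using h2
      _ = _ := by ring

end Primitive

/-- The value of the form `Q` at an integer vector. -/
def formVal (Q : ℤ × ℤ × ℤ) (u : ℤ × ℤ) : ℤ :=
  Q.1 * u.1 ^ 2 + Q.2.1 * u.1 * u.2 + Q.2.2 * u.2 ^ 2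

/-- One of the two real linear factors of a form of discriminant `4 w²`. -/
noncomputable def linXi (Q : ℤ × ℤ × ℤ) (w : ℝ) (u : ℤ × ℤ) : ℝ :=
  Q.1 * u.1 + (Q.2.1 / 2 + w) * u.2

/-- The other real linear factor of a form of discriminant `4 w²`. -/
noncomputable def linEta (Q : ℤ × ℤ × ℤ) (w : ℝ) (u : ℤ × ℤ) : ℝ :=
  u.1 + (Q.2.1 / 2 - w) / Q.1 * u.2

lemma linXi_mul_linEta {Q : ℤ × ℤ × ℤ} {w : ℝ} (hA : Q.1 ≠ 0)
    (hw : 4 * w ^ 2 = (Q.2.1 : ℝ) ^ 2 - 4 * Q.1 * Q.2.2) (u : ℤ × ℤ) :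
    linXi Q w u * linEta Q w u = formVal Q u := by
  have hA' : (Q.1 : ℝ) ≠ 0 := by exact_mod_cast hA
  simp only [linXi, linEta, formVal]
  push_cast
  field_simp
  linear_combination (-(u.2 : ℝ) ^ 2) * hw

/-- A fundamental domain for the integer vectors on which `Q` is positive, modulo multiplication
of the linear factors by powers of `± l^{±1}`. -/
def coneDomain (Q : ℤ × ℤ × ℤ) (w l : ℝ) : Set (ℤ × ℤ) :=
  {u | 0 < linEta Q w u ∧ linEta Q w u ≤ linXi Q w u ∧ linXi Q w u < l ^ 2 * linEta Q w u}

lemma finite_coneDomain_le {Q : ℤ × ℤ × ℤ} {w l : ℝ} (hA : Q.1 ≠ 0) (hw0 : 0 < w)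
    (hw : 4 * w ^ 2 = (Q.2.1 : ℝ) ^ 2 - 4 * Q.1 * Q.2.2) (T : ℝ) :
    {u | u ∈ coneDomain Q w l ∧ (formVal Q u : ℝ) ≤ T}.Finite := by
  have hA' : (Q.1 : ℝ) ≠ 0 := by exact_mod_cast hA
  have key : ∀ z : ℤ, ∀ r : ℝ, |(z : ℝ)| ≤ r → z ∈ Set.Icc (-⌈r⌉) ⌈r⌉ := by
    intro z r h
    have h1 := (abs_le.1 h).1
    have h2 := (abs_le.1 h).2
    have h3 := Int.le_ceil r
    constructor
    · exact_mod_cast (by push_cast; linarith : ((-⌈r⌉ : ℤ) : ℝ) ≤ z)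
    · exact_mod_cast h2.trans h3
  set E := |T| + 1
  set Y := (l ^ 2 * E + |(Q.1 : ℝ)| * E) / (2 * w)
  set X := E + |(Q.2.1 / 2 - w) / Q.1| * Y
  refine ((Set.finite_Icc (-⌈X⌉) ⌈X⌉).prod (Set.finite_Icc (-⌈Y⌉) ⌈Y⌉)).subset ?_
  rintro u ⟨⟨h1, h2, h3⟩, h4⟩
  rw [← linXi_mul_linEta hA hw] at h4
  have hE : |linEta Q w u| ≤ E := by
    rw [abs_of_pos h1]
    simp only [E]
    nlinarith [le_abs_self T, abs_nonneg T]
  have hXi : |linXi Q w u| ≤ l ^ 2 * E := by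
    rw [abs_of_pos (h1.trans_le h2)]
    rw [abs_of_pos h1] at hE
    exact h3.le.trans (by gcongr)
  have hy : |(u.2 : ℝ)| ≤ Y := by
    have h : (u.2 : ℝ) = (linXi Q w u - Q.1 * linEta Q w u) / (2 * w) := by
      simp only [linXi, linEta]
      field_simp
      ring
    rw [h, abs_div, abs_of_pos (by positivity : 0 < 2 * w)]
    simp only [Y]
    gcongr
    refine (abs_sub _ _).trans ?_
    rw [abs_mul]
    gcongr
  have hx : |(u.1 : ℝ)| ≤ X := by
    have h : (u.1 : ℝ) = linEta Q w u - (Q.2.1 / 2 - w) / Q.1 * u.2 := by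
      simp only [linEta]
      ring
    rw [h]
    refine (abs_sub _ _).trans ?_
    rw [abs_mul]
    simp only [X]
    gcongr
  exact ⟨key _ _ hx, key _ _ hy⟩

open scoped Pointwise in
lemma tendsto_coneCount_coneDomain {Q : ℤ × ℤ × ℤ} {w l : ℝ} (hA : Q.1 ≠ 0) (hw0 : 0 < w)
    (hw : 4 * w ^ 2 = (Q.2.1 : ℝ) ^ 2 - 4 * Q.1 * Q.2.2) (hl : 1 < l) :
    Tendsto (fun T : ℝ => (coneCount (coneDomain Q w l) (formVal Q) T : ℝ) / T) atTop
      (nhds (Real.log l / (2 * w))) := by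
  have hA' : (Q.1 : ℝ) ≠ 0 := by exact_mod_cast hA
  set m : Matrix (Fin 2) (Fin 2) ℝ :=
    !![(Q.1 : ℝ), Q.2.1 / 2 + w; 1, (Q.2.1 / 2 - w) / Q.1] with hm
  have hdet : LinearMap.det (Matrix.toLin' m) = -(2 * w) := by
    rw [LinearMap.det_toLin', hm, Matrix.det_fin_two_of]
    field_simp
    ring
  have hne : LinearMap.det (Matrix.toLin' m) ≠ 0 := by rw [hdet]; simpa using hw0.ne'
  have hlim := tendsto_card_preimage_hypSector hl (Matrix.toLin' m) hne
  rw [hdet, abs_neg, abs_of_pos (by positivity), inv_mul_eq_div] at hlim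
  refine (hlim.comp Real.tendsto_sqrt_atTop).congr' ?_
  filter_upwards [eventually_gt_atTop 0] with T hT
  have hx : 0 < √T := Real.sqrt_pos.2 hT
  simp only [Function.comp, Real.sq_sqrt hT.le]
  congr 2
  set φ : ℤ × ℤ → (Fin 2 → ℝ) := fun u => (√T)⁻¹ • ![(u.1 : ℝ), (u.2 : ℝ)] with hφ
  have hφi : Function.Injective φ := by
    intro u v h
    have h' := smul_right_injective (Fin 2 → ℝ) (inv_ne_zero hx.ne') h
    have h0 := congrFun h' 0
    have h1 := congrFun h' 1
    simp only [Matrix.cons_val_zero, Matrix.cons_val_one, Int.cast_inj] at h0 h1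
    exact Prod.ext h0 h1
  have hmem : ∀ u, φ u ∈ (Matrix.toLin' m) ⁻¹' hypSector l ↔
      u ∈ coneDomain Q w l ∧ (formVal Q u : ℝ) ≤ T := by
    intro u
    have e0 : Matrix.toLin' m (φ u) 0 = (√T)⁻¹ * linXi Q w u := by
      simp [hm, hφ, Matrix.mulVec, dotProduct, Fin.sum_univ_two, linXi]
      ring
    have e1 : Matrix.toLin' m (φ u) 1 = (√T)⁻¹ * linEta Q w u := by
      simp [hm, hφ, Matrix.mulVec, dotProduct, Fin.sum_univ_two, linEta]
      ring
    have hi : 0 < (√T)⁻¹ := inv_pos.2 hx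
    simp only [Set.mem_preimage, hypSector, Set.mem_ofPred_eq, e0, e1, coneDomain]
    rw [mul_pos_iff_of_pos_left hi, mul_le_mul_iff_right₀ hi, mul_left_comm (l ^ 2),
      mul_lt_mul_iff_right₀ hi, ← linXi_mul_linEta hA hw]
    have : (√T)⁻¹ * linXi Q w u * ((√T)⁻¹ * linEta Q w u) = linXi Q w u * linEta Q w u / T := by
      have h := Real.sq_sqrt hT.le
      field_simp
      rw [h]
      ring
    rw [this, div_le_one hT]
    tauto
  have himg : (Matrix.toLin' m) ⁻¹' hypSector l ∩
      (√T)⁻¹ • (Submodule.span ℤ (Set.range (Pi.basisFun ℝ (Fin 2))) : Set (Fin 2 → ℝ)) =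
      φ '' {u | u ∈ coneDomain Q w l ∧ (formVal Q u : ℝ) ≤ T} := by
    ext v
    constructor
    · rintro ⟨h1, z, hz, rfl⟩
      obtain ⟨c, rfl⟩ := (Submodule.mem_span_range_iff_exists_fun ℤ).1 hz
      have hc : φ (c 0, c 1) =
          (fun x : Fin 2 → ℝ => (√T)⁻¹ • x) (∑ i, c i • (Pi.basisFun ℝ (Fin 2)) i) := by
        ext i
        fin_cases i <;> simp [hφ, Fin.sum_univ_two]
      refine ⟨(c 0, c 1), ?_, hc⟩
      rw [Set.mem_ofPred_eq, ← hmem, hc]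
      exact h1
    · rintro ⟨u, hu, rfl⟩
      refine ⟨(hmem u).2 hu, ![(u.1 : ℝ), (u.2 : ℝ)], ?_, rfl⟩
      refine (Submodule.mem_span_range_iff_exists_fun ℤ).2 ⟨![u.1, u.2], ?_⟩
      ext i
      fin_cases i <;> simp [Fin.sum_univ_two]
  rw [himg, Nat.card_image_of_injective hφi]
  rfl

section Automorphs

open Matrix

/-- The action of `SL₂(ℤ)` on integer vectors. -/
def actVec (g : SpecialLinearGroup (Fin 2) ℤ) (u : ℤ × ℤ) : ℤ × ℤ :=
  (g.1 0 0 * u.1 + g.1 0 1 * u.2, g.1 1 0 * u.1 + g.1 1 1 * u.2)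

/-- The first column of a matrix in `SL₂(ℤ)`. -/
def firstCol (g : SpecialLinearGroup (Fin 2) ℤ) : ℤ × ℤ := (g.1 0 0, g.1 1 0)

lemma det_entries (g : SpecialLinearGroup (Fin 2) ℤ) :
    g.1 0 0 * g.1 1 1 - g.1 0 1 * g.1 1 0 = 1 := by
  rw [← det_fin_two, g.2]

lemma actVec_mul (g h : SpecialLinearGroup (Fin 2) ℤ) (u : ℤ × ℤ) :
    actVec (g * h) u = actVec g (actVec h u) := by
  ext <;> simp [actVec, Matrix.mul_apply, Fin.sum_univ_two] <;> ring

lemma firstCol_mul (g h : SpecialLinearGroup (Fin 2) ℤ) :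
    firstCol (g * h) = actVec g (firstCol h) := by
  ext <;> simp [actVec, firstCol, Matrix.mul_apply, Fin.sum_univ_two]

lemma actForm_mul (g h : SpecialLinearGroup (Fin 2) ℤ) (Q : ℤ × ℤ × ℤ) :
    actForm (g * h) Q = actForm h (actForm g Q) := by
  have e (i j : Fin 2) : (g * h).1 i j = g.1 i 0 * h.1 0 j + g.1 i 1 * h.1 1 j := by
    simp [Matrix.mul_apply, Fin.sum_univ_two]
  simp only [actForm, e, Prod.mk.injEq]
  refine ⟨?_, ?_, ?_⟩ <;> ring

lemma actForm_one (Q : ℤ × ℤ × ℤ) : actForm 1 Q = Q := by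
  simp [actForm]

lemma actForm_neg (g : SpecialLinearGroup (Fin 2) ℤ) (Q : ℤ × ℤ × ℤ) :
    actForm (-g) Q = actForm g Q := by
  simp [actForm]

lemma actForm_neg_form (g : SpecialLinearGroup (Fin 2) ℤ) (Q : ℤ × ℤ × ℤ) :
    actForm g (-Q) = -actForm g Q := by
  simp only [actForm, Prod.fst_neg, Prod.snd_neg, Prod.neg_mk, Prod.mk.injEq]
  refine ⟨?_, ?_, ?_⟩ <;> ring

lemma ProperEquiv.exists_actForm_eq {P Q : ℤ × ℤ × ℤ} (h : ProperEquiv P Q) :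
    ∃ g, actForm g Q = P := by
  obtain ⟨g, rfl⟩ := h
  exact ⟨g⁻¹, by rw [← actForm_mul, mul_inv_cancel, actForm_one]⟩

lemma actForm_fst (g : SpecialLinearGroup (Fin 2) ℤ) (Q : ℤ × ℤ × ℤ) :
    (actForm g Q).1 = formVal Q (firstCol g) := rfl

lemma actForm_disc (g : SpecialLinearGroup (Fin 2) ℤ) (Q : ℤ × ℤ × ℤ) :
    (actForm g Q).2.1 ^ 2 - 4 * (actForm g Q).1 * (actForm g Q).2.2 =
      Q.2.1 ^ 2 - 4 * Q.1 * Q.2.2 := by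
  have h := det_entries g
  have h2 : (g.1 0 0 * g.1 1 1 - g.1 0 1 * g.1 1 0) ^ 2 = 1 := by rw [h]; norm_num
  simp only [actForm]
  linear_combination (Q.2.1 ^ 2 - 4 * Q.1 * Q.2.2) * h2

lemma gcd_firstCol (g : SpecialLinearGroup (Fin 2) ℤ) :
    Int.gcd (firstCol g).1 (firstCol g).2 = 1 := by
  rw [← Int.isCoprime_iff_gcd_eq_one]
  refine ⟨g.1 1 1, -g.1 0 1, ?_⟩
  have h := det_entries g
  simp only [firstCol]
  linarith

lemma exists_firstCol_eq {u : ℤ × ℤ} (h : Int.gcd u.1 u.2 = 1) :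
    ∃ g : SpecialLinearGroup (Fin 2) ℤ, firstCol g = u := by
  obtain ⟨x, y, hxy⟩ := Int.isCoprime_iff_gcd_eq_one.2 h
  refine ⟨⟨!![u.1, -y; u.2, x], ?_⟩, ?_⟩
  · rw [det_fin_two_of]
    linarith
  · simp [firstCol]

lemma linEta_neg (Q : ℤ × ℤ × ℤ) (w : ℝ) (u : ℤ × ℤ) : linEta Q w (-u) = -linEta Q w u := by
  simp only [linEta, Prod.fst_neg, Prod.snd_neg, Int.cast_neg]
  ring

lemma eq_of_linXi_eq_of_linEta_eq {Q : ℤ × ℤ × ℤ} {w : ℝ} (hA : Q.1 ≠ 0) (hw : w ≠ 0)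
    {u v : ℤ × ℤ} (h1 : linXi Q w u = linXi Q w v) (h2 : linEta Q w u = linEta Q w v) :
    u = v := by
  have hA' : (Q.1 : ℝ) ≠ 0 := by exact_mod_cast hA
  simp only [linXi, linEta] at h1 h2
  have h3 : 2 * w * ((u.2 : ℝ) - v.2) = 0 := by
    have e : (Q.1 : ℝ) * ((Q.2.1 / 2 - w) / Q.1) = Q.2.1 / 2 - w := by field_simp
    linear_combination h1 - Q.1 * h2 + (u.2 - v.2 : ℝ) * e
  have h4 : (u.2 : ℝ) = v.2 := by
    have := (mul_eq_zero.1 h3).resolve_left (by simpa using hw)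
    linarith
  rw [h4] at h2
  have h5 : (u.1 : ℝ) = v.1 := by linarith
  exact Prod.ext (by exact_mod_cast h5) (by exact_mod_cast h4)

variable {A B C k : ℤ} {d w : ℝ}

/-- `g` is an automorph of `Q` scaling the two linear factors of `Q` by `r` and `r⁻¹`. -/
def IsScaling (Q : ℤ × ℤ × ℤ) (w : ℝ) (g : SpecialLinearGroup (Fin 2) ℤ) (r : ℝ) : Prop :=
  actForm g Q = Q ∧ ∀ u, linXi Q w (actVec g u) = r * linXi Q w u ∧
    linEta Q w (actVec g u) = r⁻¹ * linEta Q w u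

lemma IsScaling.mul {Q : ℤ × ℤ × ℤ} {w r s : ℝ} {g h : SpecialLinearGroup (Fin 2) ℤ}
    (hg : IsScaling Q w g r) (hh : IsScaling Q w h s) : IsScaling Q w (g * h) (r * s) := by
  refine ⟨by rw [actForm_mul, hg.1, hh.1], fun u => ?_⟩
  rw [actVec_mul, (hg.2 _).1, (hg.2 _).2, (hh.2 _).1, (hh.2 _).2, mul_inv]
  exact ⟨by ring, by ring⟩

lemma isScaling_one (Q : ℤ × ℤ × ℤ) (w : ℝ) : IsScaling Q w 1 1 :=
  ⟨actForm_one Q, fun u => by simp [actVec]⟩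

lemma IsScaling.inv {Q : ℤ × ℤ × ℤ} {w r : ℝ} {g : SpecialLinearGroup (Fin 2) ℤ}
    (hr : r ≠ 0) (hg : IsScaling Q w g r) : IsScaling Q w g⁻¹ r⁻¹ := by
  refine ⟨?_, fun u => ?_⟩
  · conv_lhs => rw [← hg.1, ← actForm_mul, mul_inv_cancel, actForm_one]
  · have h := hg.2 (actVec g⁻¹ u)
    rw [← actVec_mul, mul_inv_cancel] at h
    have h1 : actVec 1 u = u := by simp [actVec]
    rw [h1] at h
    rw [h.1, h.2]
    constructor <;> field_simp

lemma IsScaling.zpow {Q : ℤ × ℤ × ℤ} {w r : ℝ} {g : SpecialLinearGroup (Fin 2) ℤ}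
    (hr : r ≠ 0) (hg : IsScaling Q w g r) (m : ℤ) : IsScaling Q w (g ^ m) (r ^ m) := by
  induction m using Int.induction_on with
  | zero => simpa using isScaling_one Q w
  | succ i ih =>
    rw [_root_.zpow_add_one, zpow_add_one₀ hr]
    exact ih.mul hg
  | pred i ih =>
    rw [_root_.zpow_sub_one, zpow_sub_one₀ hr]
    exact ih.mul (hg.inv hr)

/-- A matrix of the shape attached to a solution `t, s` of the Pell-type equation scales the
linear factors by `(t + s √d) / 2` and `(t - s √d) / 2`. -/
lemma linXi_actVec {t s : ℤ} (hw : w = k * √d / 2) (hk : k ≠ 0) (hA : A ≠ 0)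
    (hd : d = (B : ℝ) ^ 2 - 4 * A * C) (hd0 : 0 ≤ d) {g : SpecialLinearGroup (Fin 2) ℤ}
    (ht : t = g.1 0 0 + g.1 1 1) (h10 : g.1 1 0 = A * s) (h11 : g.1 1 1 - g.1 0 0 = B * s)
    (h01 : g.1 0 1 = -(C * s)) (u : ℤ × ℤ) :
    linXi (k * A, k * B, k * C) w (actVec g u) =
      (t + s * √d) / 2 * linXi (k * A, k * B, k * C) w u ∧
    linEta (k * A, k * B, k * C) w (actVec g u) =
      (t - s * √d) / 2 * linEta (k * A, k * B, k * C) w u := by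
  have hs := Real.sq_sqrt hd0
  have hA' : (A : ℝ) ≠ 0 := by exact_mod_cast hA
  have hk' : (k : ℝ) ≠ 0 := by exact_mod_cast hk
  have h00 : (g.1 0 0 : ℝ) = (t - B * s) / 2 := by
    have : 2 * g.1 0 0 = t - B * s := by linarith
    have : (2 : ℝ) * g.1 0 0 = t - B * s := by exact_mod_cast this
    linarith
  have h11' : (g.1 1 1 : ℝ) = (t + B * s) / 2 := by
    have : 2 * g.1 1 1 = t + B * s := by linarith
    have : (2 : ℝ) * g.1 1 1 = t + B * s := by exact_mod_cast this
    linarith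
  simp only [linXi, linEta, actVec, h10, h01, hw]
  push_cast
  rw [h00, h11']
  generalize √d = e at hs ⊢
  rw [hd] at hs
  constructor
  · linear_combination (-(k * s * u.2 : ℝ) / 4) * hs
  · field_simp
    linear_combination (-(s * u.2 : ℝ)) * hs

lemma exists_isScaling {t s : ℤ} (hw : w = k * √d / 2) (hk : k ≠ 0) (hA : A ≠ 0)
    (hd : d = (B : ℝ) ^ 2 - 4 * A * C) (hd0 : 0 ≤ d)
    (hpell : t ^ 2 - (B ^ 2 - 4 * A * C) * s ^ 2 = 4) :
    ∃ g, IsScaling (k * A, k * B, k * C) w g ((t + s * √d) / 2) := by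
  have hpar : ∃ e, t = 2 * e + B * s := by
    have h1 : Even (t ^ 2 - (B * s) ^ 2) :=
      ⟨2 - 2 * A * C * s ^ 2, by linear_combination hpell⟩
    rw [sq_sub_sq, Int.even_mul, Int.even_add, Int.even_sub] at h1
    have h2 : Even (t - B * s) := by rw [Int.even_sub]; tauto
    obtain ⟨e, he⟩ := h2
    exact ⟨e, by linarith⟩
  obtain ⟨e, he⟩ := hpar
  have hdet : e * (e + B * s) + A * C * s ^ 2 = 1 := by
    rw [he] at hpell
    linarith
  let g : SpecialLinearGroup (Fin 2) ℤ := ⟨!![e, -(C * s); A * s, e + B * s], by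
    rw [det_fin_two_of]; linear_combination hdet⟩
  have hr : ((t : ℝ) - s * √d) / 2 = ((t + s * √d) / 2)⁻¹ := by
    refine eq_inv_of_mul_eq_one_left ?_
    have hs := Real.sq_sqrt hd0
    have hp : (t : ℝ) ^ 2 - (B ^ 2 - 4 * A * C) * s ^ 2 = 4 := by exact_mod_cast hpell
    rw [← hd] at hp
    linear_combination hp / 4 - (s : ℝ) ^ 2 / 4 * hs
  refine ⟨g, ?_, fun u => ?_⟩
  · simp only [actForm, g, of_apply, cons_val', cons_val_zero, cons_val_one, cons_val_fin_one,
      Prod.mk.injEq]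
    refine ⟨?_, ?_, ?_⟩
    · linear_combination (k * A) * hdet
    · linear_combination (k * B) * hdet
    · linear_combination (k * C) * hdet
  · rw [← hr]
    refine linXi_actVec hw hk hA hd hd0 ?_ ?_ ?_ ?_ u <;> simp [g]
    linear_combination he

lemma exists_pell_of_actForm_eq {x y z : ℤ} (hk : k ≠ 0) (hbez : A * x + B * y + C * z = 1)
    {g : SpecialLinearGroup (Fin 2) ℤ}
    (hg : actForm g (k * A, k * B, k * C) = (k * A, k * B, k * C)) :
    ∃ s : ℤ, g.1 1 0 = A * s ∧ g.1 1 1 - g.1 0 0 = B * s ∧ g.1 0 1 = -(C * s) ∧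
      (g.1 0 0 + g.1 1 1) ^ 2 - (B ^ 2 - 4 * A * C) * s ^ 2 = 4 := by
  have hdet := det_entries g
  simp only [actForm, Prod.mk.injEq] at hg
  set p := g.1 0 0
  set q := g.1 0 1
  set r := g.1 1 0
  set v := g.1 1 1
  obtain ⟨h1, h2, h3⟩ := hg
  have e1 : A * p ^ 2 + B * p * r + C * r ^ 2 = A :=
    mul_left_cancel₀ hk (by linear_combination h1)
  have e2 : 2 * A * p * q + B * (p * v + q * r) + 2 * C * r * v = B :=
    mul_left_cancel₀ hk (by linear_combination h2)
  have e3 : A * q ^ 2 + B * q * v + C * v ^ 2 = C :=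
    mul_left_cancel₀ hk (by linear_combination h3)
  have f1 : A * (v - p) = B * r := mul_left_cancel₀ two_ne_zero (by
    linear_combination -(2 * v * e1) + r * e2 + (2 * A * p + B * r) * hdet)
  have f2 : A * q = -(C * r) := mul_left_cancel₀ two_ne_zero (by
    linear_combination v * e2 - 2 * r * e3 - (2 * A * q + B * v) * hdet)
  have f3 : C * (v - p) = -(B * q) := mul_left_cancel₀ two_ne_zero (by
    linear_combination -q * e2 + 2 * p * e3 - (B * q + 2 * C * v) * hdet)
  have hr : r = A * (x * r + y * (v - p) + z * (-q)) := by
    linear_combination -r * hbez - y * f1 + z * f2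
  have hv : v - p = B * (x * r + y * (v - p) + z * (-q)) := by
    linear_combination -(v - p) * hbez + x * f1 + z * f3
  have hq : q = -(C * (x * r + y * (v - p) + z * (-q))) := by
    linear_combination -q * hbez + x * f2 + y * f3
  refine ⟨x * r + y * (v - p) + z * (-q), hr, hv, hq, ?_⟩
  generalize x * r + y * (v - p) + z * (-q) = s at hr hv hq ⊢
  linear_combination 4 * hdet + 4 * r * hq - 4 * C * s * hr + (v - p + B * s) * hv

end Automorphs

section FundamentalDomain

open Matrix

/-- `(t₀, s₀)` is the minimal positive solution of `t² - D s² = 4`. -/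
structure IsMinimalPell (D t₀ s₀ : ℤ) : Prop where
  disc_pos : 0 < D
  t_pos : 0 < t₀
  s_pos : 0 < s₀
  eq : t₀ ^ 2 - D * s₀ ^ 2 = 4
  le : ∀ t s : ℤ, 0 < t → 0 < s → t ^ 2 - D * s ^ 2 = 4 → t₀ ≤ t

/-- The real number `(t + s √D) / 2`. -/
noncomputable def pellUnit (D t s : ℤ) : ℝ := (t + s * √(D : ℝ)) / 2

lemma pellUnit_mul_pellUnit_neg {D t s : ℤ} (hD : 0 ≤ D) (h : t ^ 2 - D * s ^ 2 = 4) :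
    pellUnit D t s * pellUnit D t (-s) = 1 := by
  have hs := Real.sq_sqrt (by exact_mod_cast hD : (0 : ℝ) ≤ D)
  have hp : (t : ℝ) ^ 2 - D * s ^ 2 = 4 := by exact_mod_cast h
  simp only [pellUnit]
  push_cast
  linear_combination hp / 4 - (s : ℝ) ^ 2 / 4 * hs

lemma IsMinimalPell.one_lt {D t₀ s₀ : ℤ} (h : IsMinimalPell D t₀ s₀) :
    1 < pellUnit D t₀ s₀ := by
  have h1 := pellUnit_mul_pellUnit_neg h.disc_pos.le h.eq
  have hD : 0 < √(D : ℝ) := Real.sqrt_pos.2 (by exact_mod_cast h.disc_pos)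
  have ht : (0 : ℝ) < t₀ := by exact_mod_cast h.t_pos
  have hs : (0 : ℝ) < s₀ := by exact_mod_cast h.s_pos
  have hpos : 0 < pellUnit D t₀ s₀ := by simp only [pellUnit]; positivity
  have hlt : pellUnit D t₀ (-s₀) < pellUnit D t₀ s₀ := by
    simp only [pellUnit]
    push_cast
    nlinarith [mul_pos hs hD]
  by_contra! hle
  nlinarith

lemma IsMinimalPell.eq_of_lt {D t₀ s₀ t s : ℤ} (h : IsMinimalPell D t₀ s₀)
    (hts : t ^ 2 - D * s ^ 2 = 4) (h1 : 1 ≤ pellUnit D t s)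
    (h2 : pellUnit D t s < pellUnit D t₀ s₀) : t = 2 ∧ s = 0 := by
  have hl := h.one_lt
  have e1 := pellUnit_mul_pellUnit_neg h.disc_pos.le h.eq
  have e2 := pellUnit_mul_pellUnit_neg h.disc_pos.le hts
  have s1 : pellUnit D t₀ s₀ + pellUnit D t₀ (-s₀) = t₀ := by
    simp only [pellUnit]; push_cast; ring
  have s2 : pellUnit D t s + pellUnit D t (-s) = t := by
    simp only [pellUnit]; push_cast; ring
  have s3 : pellUnit D t s - pellUnit D t (-s) = s * √(D : ℝ) := by
    simp only [pellUnit]; push_cast; ring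
  have hD : 0 < √(D : ℝ) := Real.sqrt_pos.2 (by exact_mod_cast h.disc_pos)
  generalize pellUnit D t₀ s₀ = l at *
  generalize pellUnit D t₀ (-s₀) = l' at *
  generalize pellUnit D t s = r at *
  generalize pellUnit D t (-s) = r' at *
  have hr' : 0 < r' := pos_of_mul_pos_right (by rw [e2]; exact one_pos) (by linarith)
  have hl' : 0 < l' := pos_of_mul_pos_right (by rw [e1]; exact one_pos) (by linarith)
  have hr'1 : r' ≤ 1 := by nlinarith
  have hl'1 : l' < 1 := by nlinarith
  have ht : (0 : ℝ) < t := by linarith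
  have ht' : 0 < t := by exact_mod_cast ht
  have hs : (0 : ℝ) ≤ s := by
    by_contra! hneg
    nlinarith
  have hs' : 0 ≤ s := by exact_mod_cast hs
  rcases hs'.eq_or_lt with rfl | hs0
  · refine ⟨?_, rfl⟩
    nlinarith
  · exfalso
    have h3 : (t₀ : ℝ) ≤ t := by exact_mod_cast h.le t s ht' hs0 hts
    have h4 : 0 < (l - r) * (1 - l' * r') := mul_pos (by linarith) (by nlinarith)
    have h5 : (l - r) * (1 - l' * r') = t₀ - t := by
      rw [← s1, ← s2]
      linear_combination -r' * e1 + l' * e2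
    linarith

/-- Numerical data attached to the form `k * [A, B, C]`, where `[A, B, C]` is primitive of positive
discriminant `D`. -/
structure IsScaledForm (A B C k D : ℤ) : Prop where
  scale_pos : 0 < k
  fst_ne : A ≠ 0
  bezout : ∃ x y z, A * x + B * y + C * z = 1
  disc : D = B ^ 2 - 4 * A * C
  disc_pos : 0 < D

variable {A B C k D t₀ s₀ : ℤ}

lemma IsScaledForm.sq_root (h : IsScaledForm A B C k D) :
    4 * (k * √(D : ℝ) / 2) ^ 2 =
      ((k * B : ℤ) : ℝ) ^ 2 - 4 * ((k * A : ℤ) : ℝ) * ((k * C : ℤ) : ℝ) := by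
  have hs := Real.sq_sqrt (by exact_mod_cast h.disc_pos.le : (0 : ℝ) ≤ D)
  have hd : (D : ℝ) = B ^ 2 - 4 * A * C := by exact_mod_cast h.disc
  push_cast
  linear_combination (k : ℝ) ^ 2 * hs + (k : ℝ) ^ 2 * hd

lemma IsScaledForm.root_pos (h : IsScaledForm A B C k D) : 0 < k * √(D : ℝ) / 2 := by
  have h1 : (0 : ℝ) < k := by exact_mod_cast h.scale_pos
  have h2 : (0 : ℝ) < D := by exact_mod_cast h.disc_pos
  positivity

lemma IsScaledForm.linXi_mul_linEta (h : IsScaledForm A B C k D) (u : ℤ × ℤ) :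
    linXi (k * A, k * B, k * C) (k * √(D : ℝ) / 2) u *
      linEta (k * A, k * B, k * C) (k * √(D : ℝ) / 2) u = formVal (k * A, k * B, k * C) u :=
  _root_.linXi_mul_linEta (mul_ne_zero h.scale_pos.ne' h.fst_ne) h.sq_root u

lemma exists_firstCol_mem_coneDomain (h : IsScaledForm A B C k D) (hp : IsMinimalPell D t₀ s₀)
    {P : ℤ × ℤ × ℤ} (hP : 0 < P.1) {g : SpecialLinearGroup (Fin 2) ℤ}
    (hg : actForm g (k * A, k * B, k * C) = P) :
    ∃ g', actForm g' (k * A, k * B, k * C) = P ∧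
      firstCol g' ∈ coneDomain (k * A, k * B, k * C) (k * √(D : ℝ) / 2) (pellUnit D t₀ s₀) := by
  obtain ⟨M, hM⟩ := exists_isScaling (w := k * √(D : ℝ) / 2) (d := (D : ℝ)) (t := t₀) (s := s₀) rfl
    h.scale_pos.ne' h.fst_ne (by exact_mod_cast h.disc) (by exact_mod_cast h.disc_pos.le)
    (by rw [← h.disc]; exact hp.eq)
  have hpos : ∀ g₁, actForm g₁ (k * A, k * B, k * C) = P →
      0 < linXi (k * A, k * B, k * C) (k * √(D : ℝ) / 2) (firstCol g₁) *
        linEta (k * A, k * B, k * C) (k * √(D : ℝ) / 2) (firstCol g₁) := by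
    intro g₁ hg₁
    rw [h.linXi_mul_linEta, ← actForm_fst, hg₁]
    exact_mod_cast hP
  obtain ⟨g₁, hg₁, heta⟩ : ∃ g₁, actForm g₁ (k * A, k * B, k * C) = P ∧
      0 < linEta (k * A, k * B, k * C) (k * √(D : ℝ) / 2) (firstCol g₁) := by
    rcases lt_trichotomy (linEta (k * A, k * B, k * C) (k * √(D : ℝ) / 2) (firstCol g)) 0
      with h0 | h0 | h0
    · refine ⟨-g, by rw [actForm_neg, hg], ?_⟩
      have : firstCol (-g) = -firstCol g := by
        ext <;> simp [firstCol]
      rw [this, linEta_neg]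
      linarith
    · have := hpos g hg
      rw [h0, mul_zero] at this
      exact absurd this (lt_irrefl _)
    · exact ⟨g, hg, h0⟩
  have hxi := pos_of_mul_pos_left (hpos g₁ hg₁) heta.le
  have hl := hp.one_lt
  have hl0 : 0 < pellUnit D t₀ s₀ := one_pos.trans hl
  obtain ⟨m, hm1, hm2⟩ := exists_mem_Ico_zpow (div_pos hxi heta)
    (one_lt_pow₀ hl two_ne_zero)
  have hMm := hM.zpow (r := pellUnit D t₀ s₀) hl0.ne' (-m)
  refine ⟨M ^ (-m) * g₁, by rw [actForm_mul, hMm.1, hg₁], ?_⟩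
  have hc := hMm.2 (firstCol g₁)
  rw [le_div_iff₀ heta] at hm1
  rw [div_lt_iff₀ heta] at hm2
  rw [coneDomain, Set.mem_ofPred_eq, firstCol_mul, hc.1, hc.2]
  have hz : 0 < pellUnit D t₀ s₀ ^ m := zpow_pos hl0 m
  have e1 : (pellUnit D t₀ s₀ ^ 2) ^ m = pellUnit D t₀ s₀ ^ m * pellUnit D t₀ s₀ ^ m := by
    rw [← zpow_natCast, ← _root_.zpow_mul, ← zpow_add₀ hl0.ne']
    congr 1
    push_cast
    ring
  rw [zpow_add_one₀ (by positivity), e1] at hm2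
  rw [e1] at hm1
  rw [_root_.zpow_neg, inv_inv]
  refine ⟨by positivity, ?_, ?_⟩
  · rw [inv_mul_eq_div, le_div_iff₀ hz]
    linarith
  · rw [inv_mul_eq_div, div_lt_iff₀ hz]
    linarith

lemma scale_lt_of_mem_strip {l r r' X E : ℝ} (hl : 1 < l) (hr : r * r' = 1) (hE : 0 < E)
    (h1 : E ≤ X) (h2 : X < l ^ 2 * E) (hE' : 0 < r' * E) (h1' : r' * E ≤ r * X)
    (h2' : r * X < l ^ 2 * (r' * E)) : r < l ∧ r' < l ∧ 0 < r ∧ 0 < r' := by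
  have hr' : 0 < r' := pos_of_mul_pos_left hE' hE.le
  have hr0 : 0 < r := pos_of_mul_pos_left (by rw [hr]; exact one_pos) hr'.le
  have hl2 : 0 < l := one_pos.trans hl
  refine ⟨?_, ?_, hr0, hr'⟩
  · by_contra! hle
    have e1 : r ^ 2 * X < l ^ 2 * E := by
      calc r ^ 2 * X = r * (r * X) := by ring
        _ < r * (l ^ 2 * (r' * E)) := mul_lt_mul_of_pos_left h2' hr0
        _ = l ^ 2 * E * (r * r') := by ring
        _ = l ^ 2 * E := by rw [hr, mul_one]
    have e2 : l ^ 2 * E ≤ r ^ 2 * X := by gcongr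
    linarith
  · by_contra! hle
    have e1 : r' ^ 2 * E ≤ X := by
      calc r' ^ 2 * E = r' * (r' * E) := by ring
        _ ≤ r' * (r * X) := by gcongr
        _ = (r * r') * X := by ring
        _ = X := by rw [hr, one_mul]
    have e2 : l ^ 2 * E ≤ r' ^ 2 * E := by gcongr
    linarith

lemma firstCol_eq_of_mem_coneDomain (h : IsScaledForm A B C k D) (hp : IsMinimalPell D t₀ s₀)
    {g g' : SpecialLinearGroup (Fin 2) ℤ}
    (hgg' : actForm g (k * A, k * B, k * C) = actForm g' (k * A, k * B, k * C))
    (hg : firstCol g ∈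
      coneDomain (k * A, k * B, k * C) (k * √(D : ℝ) / 2) (pellUnit D t₀ s₀))
    (hg' : firstCol g' ∈
      coneDomain (k * A, k * B, k * C) (k * √(D : ℝ) / 2) (pellUnit D t₀ s₀)) :
    firstCol g = firstCol g' := by
  obtain ⟨x, y, z, hb⟩ := h.bezout
  have hk := h.scale_pos.ne'
  have hγ : actForm (g' * g⁻¹) (k * A, k * B, k * C) = (k * A, k * B, k * C) := by
    rw [actForm_mul, ← hgg', ← actForm_mul, mul_inv_cancel, actForm_one]
  obtain ⟨s, h10, h11, h01, hpell⟩ := exists_pell_of_actForm_eq hk hb hγ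
  have hcol : firstCol g' = actVec (g' * g⁻¹) (firstCol g) := by
    rw [← firstCol_mul, inv_mul_cancel_right]
  obtain ⟨t, ht⟩ : ∃ t, t = (g' * g⁻¹).1 0 0 + (g' * g⁻¹).1 1 1 := ⟨_, rfl⟩
  have hact := linXi_actVec (w := k * √(D : ℝ) / 2) rfl hk h.fst_ne
    (by exact_mod_cast h.disc) (by exact_mod_cast h.disc_pos.le) ht h10 h11 h01 (firstCol g)
  rw [← hcol] at hact
  rw [← ht, ← h.disc] at hpell
  have hpell' : t ^ 2 - D * (-s) ^ 2 = 4 := by rw [neg_sq]; exact hpell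
  have hr : ((t : ℝ) + s * √(D : ℝ)) / 2 = pellUnit D t s := rfl
  have hr' : ((t : ℝ) - s * √(D : ℝ)) / 2 = pellUnit D t (-s) := by
    simp only [pellUnit]; push_cast; ring
  rw [hr, hr'] at hact
  have e := pellUnit_mul_pellUnit_neg h.disc_pos.le hpell
  have hl := hp.one_lt
  have hst : t = 2 ∧ s = 0 := by
    have key := hp.eq_of_lt hpell
    have key' := hp.eq_of_lt hpell'
    obtain ⟨a1, a2, a3⟩ := hg
    obtain ⟨b1, b2, b3⟩ := hg'
    rw [hact.1, hact.2] at b2 b3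
    rw [hact.2] at b1
    obtain ⟨c1, c2, c3, c4⟩ := scale_lt_of_mem_strip hl e a1 a2 a3 b1 b2 b3
    rcases le_total 1 (pellUnit D t s) with h1 | h1
    · exact key h1 c1
    · have h2 : 1 ≤ pellUnit D t (-s) := by nlinarith
      obtain ⟨d1, d2⟩ := key' h2 c2
      exact ⟨d1, neg_eq_zero.1 d2⟩
  have hone : pellUnit D t s = 1 ∧ pellUnit D t (-s) = 1 := by
    rw [hst.1, hst.2]
    simp [pellUnit]
  rw [hone.1, hone.2, one_mul, one_mul] at hact
  exact eq_of_linXi_eq_of_linEta_eq (mul_ne_zero hk h.fst_ne) h.root_pos.ne' hact.1.symm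
    hact.2.symm

lemma exists_translate {u : ℤ × ℤ} {Q : ℤ × ℤ × ℤ} (hQ : Even Q.2.1)
    (hu : Int.gcd u.1 u.2 = 1) (hpos : 0 < formVal Q u) :
    ∃ g, ∃ b c : ℤ, firstCol g = u ∧ 0 ≤ b ∧ b < formVal Q u ∧
      actForm g Q = (formVal Q u, 2 * b, c) := by
  obtain ⟨g, rfl⟩ := exists_firstCol_eq hu
  obtain ⟨b, hb⟩ : ∃ b, (actForm g Q).2.1 = 2 * b := by
    obtain ⟨e, he⟩ := hQ
    refine ⟨Q.1 * g.1 0 0 * g.1 0 1 + e * (g.1 0 0 * g.1 1 1 + g.1 0 1 * g.1 1 0) +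
      Q.2.2 * g.1 1 0 * g.1 1 1, ?_⟩
    simp only [actForm, he]
    ring
  set a := formVal Q (firstCol g) with ha
  let S : SpecialLinearGroup (Fin 2) ℤ := ⟨!![1, -(b / a); 0, 1], by simp⟩
  refine ⟨g * S, b % a, (actForm (g * S) Q).2.2, ?_, Int.emod_nonneg _ hpos.ne',
    Int.emod_lt_of_pos _ hpos, ?_⟩
  · rw [firstCol_mul]
    ext <;> simp [actVec, firstCol, S]
  · have h1 : (actForm g Q).1 = a := actForm_fst g Q
    rw [actForm_mul]
    generalize actForm g Q = P at *
    obtain ⟨P1, P2, P3⟩ := P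
    simp only at h1 hb
    simp [actForm, S, h1, hb]
    rw [Int.emod_def]
    ring

lemma eq_of_firstCol_eq {Q : ℤ × ℤ × ℤ} {a b c b' c' : ℤ}
    {g g' : SpecialLinearGroup (Fin 2) ℤ} (h : firstCol g = firstCol g')
    (hg : actForm g Q = (a, 2 * b, c)) (hg' : actForm g' Q = (a, 2 * b', c'))
    (hb : 0 ≤ b) (hba : b < a) (hb' : 0 ≤ b') (hba' : b' < a) : c = c' := by
  have hu : firstCol (g⁻¹ * g') = (1, 0) := by
    rw [firstCol_mul, ← h, ← firstCol_mul, inv_mul_cancel]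
    simp [firstCol]
  have hact : actForm (g⁻¹ * g') (a, 2 * b, c) = (a, 2 * b', c') := by
    rw [← hg, ← hg', ← actForm_mul, mul_inv_cancel_left]
  have hdet := det_entries (g⁻¹ * g')
  simp only [firstCol, Prod.mk.injEq] at hu
  simp only [actForm, hu.1, hu.2] at hact hdet
  generalize (g⁻¹ * g').1 1 1 = v at *
  generalize (g⁻¹ * g').1 0 1 = m at *
  obtain rfl : v = 1 := by linarith
  simp only [Prod.mk.injEq] at hact
  obtain ⟨-, h2, h3⟩ := hact
  have h4 : b + a * m = b' := by linarith
  have h5 : m = 0 := by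
    by_contra hm
    rcases lt_or_gt_of_ne hm with hm | hm <;> nlinarith
  rw [h5] at h3
  linarith

end FundamentalDomain

section Counting

variable {A B C k D t₀ s₀ n : ℤ}

/-- The `D(n)`-pairs `{a, c}` with `n < a ≤ T` and `c < a` whose form is properly equivalent
to `Q`. -/
def pairsAbove (n : ℤ) (Q : ℤ × ℤ × ℤ) (T : ℝ) : Set (ℤ × ℤ) :=
  {ac | n < ac.1 ∧ (ac.1 : ℝ) ≤ T ∧ ac.2 < ac.1 ∧ ac.2 ≠ 0 ∧
    ∃ b : ℤ, 0 ≤ b ∧ b ^ 2 = ac.1 * ac.2 + n ∧ ProperEquiv (ac.1, 2 * b, ac.2) Q}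

lemma snd_pos_of_mem_pairsAbove (hn : 0 < n) {Q : ℤ × ℤ × ℤ} {T : ℝ} {ac : ℤ × ℤ}
    (h : ac ∈ pairsAbove n Q T) : 0 < ac.2 := by
  obtain ⟨h1, -, -, h2, b, -, hb, -⟩ := h
  refine lt_of_le_of_ne ?_ h2.symm
  by_contra! hneg
  nlinarith [sq_nonneg b]

lemma finite_pairsAbove (hn : 0 < n) (Q : ℤ × ℤ × ℤ) (T : ℝ) : (pairsAbove n Q T).Finite := by
  refine ((Set.finite_Icc 0 ⌊T⌋).prod (Set.finite_Icc 0 ⌊T⌋)).subset fun ac h => ?_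
  have h0 := snd_pos_of_mem_pairsAbove hn h
  obtain ⟨h1, h2, h3, -⟩ := h
  have h4 := Int.le_floor.2 h2
  exact ⟨⟨by omega, h4⟩, ⟨h0.le, by omega⟩⟩

lemma exists_pair_of_mem_coneDomain (h : IsScaledForm A B C k D) (hn : 0 < n)
    (hns : ¬∃ m : ℤ, n = m ^ 2) (hkD : D * k ^ 2 = 4 * n) {u : ℤ × ℤ}
    (hu : Int.gcd u.1 u.2 = 1) (hnu : n < formVal (k * A, k * B, k * C) u) :
    ∃ c, c < formVal (k * A, k * B, k * C) u ∧ c ≠ 0 ∧ ∃ g b, firstCol g = u ∧ 0 ≤ b ∧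
      b < formVal (k * A, k * B, k * C) u ∧ b ^ 2 = formVal (k * A, k * B, k * C) u * c + n ∧
      actForm g (k * A, k * B, k * C) = (formVal (k * A, k * B, k * C) u, 2 * b, c) := by
  have hdisc : (k * B) ^ 2 - 4 * (k * A) * (k * C) = 4 * n := by
    rw [← hkD, h.disc]
    ring
  have heven : Even (k * B) := by
    have : Even ((k * B) ^ 2) := ⟨2 * (n + k * A * (k * C)), by linarith⟩
    exact (Int.even_pow.1 this).1
  obtain ⟨g, b, c, hg, hb0, hb1, hact⟩ := exists_translate (Q := (k * A, k * B, k * C))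
    heven hu (hn.trans hnu)
  have hd := actForm_disc g (k * A, k * B, k * C)
  rw [hact] at hd
  simp only at hd
  rw [hdisc] at hd
  have hsq : b ^ 2 = formVal (k * A, k * B, k * C) u * c + n := by linarith
  refine ⟨c, ?_, ?_, g, b, hg, hb0, hb1, hsq, hact⟩
  · nlinarith
  · rintro rfl
    exact hns ⟨b, by linarith⟩

lemma ncard_pairsAbove (h : IsScaledForm A B C k D) (hp : IsMinimalPell D t₀ s₀) (hn : 0 < n)
    (hns : ¬∃ m : ℤ, n = m ^ 2) (hkD : D * k ^ 2 = 4 * n) (T : ℝ) :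
    (pairsAbove n (k * A, k * B, k * C) T).ncard =
      {u | (u ∈ coneDomain (k * A, k * B, k * C) (k * √(D : ℝ) / 2) (pellUnit D t₀ s₀) ∧
        Int.gcd u.1 u.2 = 1) ∧ n < formVal (k * A, k * B, k * C) u ∧
        (formVal (k * A, k * B, k * C) u : ℝ) ≤ T}.ncard := by
  have hex := fun u hu hnu => exists_pair_of_mem_coneDomain h hn hns hkD (u := u) hu hnu
  choose f hf1 hf2 hf3 using hex
  symm
  refine Set.ncard_congr (fun u hu => (formVal (k * A, k * B, k * C) u, f u hu.1.2 hu.2.1))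
    ?_ ?_ ?_
  · intro u hu
    obtain ⟨g, b, hg, hb0, -, hsq, hact⟩ := hf3 u hu.1.2 hu.2.1
    refine ⟨hu.2.1, hu.2.2, hf1 u hu.1.2 hu.2.1, hf2 u hu.1.2 hu.2.1, b, hb0, hsq, g⁻¹, ?_⟩
    rw [← hact, ← actForm_mul, mul_inv_cancel, actForm_one]
  · intro u v hu hv huv
    obtain ⟨g, b, hg, hb0, -, hsq, hact⟩ := hf3 u hu.1.2 hu.2.1
    obtain ⟨g', b', hg', hb0', -, hsq', hact'⟩ := hf3 v hv.1.2 hv.2.1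
    simp only [Prod.mk.injEq] at huv
    rw [huv.2, huv.1] at hsq hact
    obtain rfl : b = b' := by
      rw [← hsq'] at hsq
      exact (sq_eq_sq₀ hb0 hb0').1 hsq
    rw [← hg, ← hg']
    exact firstCol_eq_of_mem_coneDomain h hp (hact.trans hact'.symm) (hg ▸ hu.1.1)
      (hg' ▸ hv.1.1)
  · rintro ⟨a, c⟩ ⟨h1, h2, h3, h4, b, hb0, hb, hequiv⟩
    simp only at h1 h2 h3 h4 hb hequiv
    obtain ⟨g, hg⟩ := hequiv.exists_actForm_eq
    obtain ⟨g', hg', hmem⟩ := exists_firstCol_mem_coneDomain h hp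
      (P := (a, 2 * b, c)) (hn.trans h1) hg
    have ha : formVal (k * A, k * B, k * C) (firstCol g') = a := by
      rw [← actForm_fst, hg']
    have hu1 := gcd_firstCol g'
    have hu2 : n < formVal (k * A, k * B, k * C) (firstCol g') := by rw [ha]; exact h1
    refine ⟨firstCol g', ⟨⟨hmem, hu1⟩, hu2, by rw [ha]; exact h2⟩, ?_⟩
    obtain ⟨g₁, b₁, hg₁, hb₁, hlt, -, hact⟩ := hf3 (firstCol g') hu1 hu2
    have hba : b < a := by nlinarith
    refine Prod.ext ha ?_
    simp only
    rw [ha] at hact hlt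
    exact eq_of_firstCol_eq hg₁ hact hg' hb₁ hlt hb0 hba

lemma tendsto_ncard_pairsAbove (h : IsScaledForm A B C k D) (hp : IsMinimalPell D t₀ s₀)
    (hn : 0 < n) (hns : ¬∃ m : ℤ, n = m ^ 2) (hkD : D * k ^ 2 = 4 * n) :
    Tendsto (fun T : ℝ => ((pairsAbove n (k * A, k * B, k * C) T).ncard : ℝ) / T) atTop
      (nhds (6 / π ^ 2 * (log (pellUnit D t₀ s₀) / (2 * (k * √(D : ℝ) / 2))))) := by
  have hA := mul_ne_zero h.scale_pos.ne' h.fst_ne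
  have hl0 : 0 < pellUnit D t₀ s₀ := one_pos.trans hp.one_lt
  have hsmul : ∀ (d : ℤ) u, (linEta (k * A, k * B, k * C) (k * √(D : ℝ) / 2) (d • u) =
      d * linEta (k * A, k * B, k * C) (k * √(D : ℝ) / 2) u) ∧
      (linXi (k * A, k * B, k * C) (k * √(D : ℝ) / 2) (d • u) =
      d * linXi (k * A, k * B, k * C) (k * √(D : ℝ) / 2) u) := by
    intro d u
    simp only [linEta, linXi, Prod.smul_fst, Prod.smul_snd, smul_eq_mul]
    push_cast
    constructor <;> ring
  have hfin := fun T => finite_coneDomain_le (Q := (k * A, k * B, k * C))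
    (l := pellUnit D t₀ s₀) hA h.root_pos h.sq_root T
  have key := tendsto_coneCount_primitive
    (D := coneDomain (k * A, k * B, k * C) (k * √(D : ℝ) / 2) (pellUnit D t₀ s₀))
    (q := formVal (k * A, k * B, k * C)) ?_ ?_ ?_ hfin
    (tendsto_coneCount_coneDomain hA h.root_pos h.sq_root hp.one_lt)
  · have hzero := key.sub (tendsto_const_nhds.div_atTop tendsto_id (a := (coneCount
      {u | u ∈ coneDomain (k * A, k * B, k * C) (k * √(D : ℝ) / 2) (pellUnit D t₀ s₀) ∧
        Int.gcd u.1 u.2 = 1} (formVal (k * A, k * B, k * C)) n : ℝ)))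
    rw [sub_zero] at hzero
    refine hzero.congr' ?_
    filter_upwards [eventually_ge_atTop (n : ℝ)] with T hT
    rw [ncard_pairsAbove h hp hn hns hkD, id, ← sub_div]
    congr 1
    rw [sub_eq_iff_eq_add, ← Nat.cast_add, Nat.cast_inj, coneCount, coneCount,
      ← Set.ncard_union_eq _ ((hfin T).subset _) ((hfin n).subset _)]
    · congr 1
      ext u
      simp only [Set.mem_union, Set.mem_ofPred_eq, Int.cast_le]
      constructor
      · rintro ⟨h1, h2⟩
        rcases lt_or_ge n (formVal (k * A, k * B, k * C) u) with h3 | h3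
        · exact Or.inl ⟨h1, h3, h2⟩
        · exact Or.inr ⟨h1, h3⟩
      · rintro (⟨h1, -, h2⟩ | ⟨h1, h2⟩)
        · exact ⟨h1, h2⟩
        · exact ⟨h1, le_trans (by exact_mod_cast h2) hT⟩
    · rw [Set.disjoint_left]
      rintro u ⟨-, h1, -⟩ ⟨-, h2⟩
      have : formVal (k * A, k * B, k * C) u ≤ n := by exact_mod_cast h2
      omega
    · exact fun u hu => ⟨hu.1.1, hu.2.2⟩
    · exact fun u hu => ⟨hu.1.1, hu.2⟩
  · intro d u hd
    have hd' : (0 : ℝ) < d := by exact_mod_cast hd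
    simp only [coneDomain, Set.mem_ofPred_eq, (hsmul d u).1, (hsmul d u).2]
    rw [mul_pos_iff_of_pos_left hd', mul_le_mul_iff_right₀ hd', mul_left_comm (_ ^ 2) (d : ℝ),
      mul_lt_mul_iff_right₀ hd']
  · intro d u
    simp only [formVal, Prod.smul_fst, Prod.smul_snd, smul_eq_mul]
    ring
  · rintro u ⟨h1, h2, -⟩
    have h3 := mul_pos (h1.trans_le h2) h1
    rw [h.linXi_mul_linEta] at h3
    have : 0 < formVal (k * A, k * B, k * C) u := by exact_mod_cast h3
    omega

lemma ProperEquiv.neg_swap {a b c : ℤ} {Q : ℤ × ℤ × ℤ} (h : ProperEquiv (a, 2 * b, c) Q) :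
    ProperEquiv (-c, 2 * b, -a) (-Q) := by
  obtain ⟨g, rfl⟩ := h
  let S : Matrix.SpecialLinearGroup (Fin 2) ℤ := ⟨!![0, -1; 1, 0], by simp⟩
  refine ⟨S * g, ?_⟩
  rw [actForm_mul, ← actForm_neg_form]
  congr 1
  simp [actForm, S]

lemma dtq_bounds (hn : 0 < n) (Q : ℤ × ℤ × ℤ) (T : ℝ) :
    (pairsAbove n Q T).ncard + (pairsAbove n (-Q) T).ncard ≤ DTQ n Q T ∧
    DTQ n Q T ≤ (pairsAbove n Q T).ncard + (pairsAbove n (-Q) T).ncard +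
      (Set.Icc (-n) n ×ˢ Set.Icc (-n) n).ncard := by
  have hinj : Function.Injective fun x : ℤ × ℤ => (-x.2, -x.1) := by
    rintro ⟨a, c⟩ ⟨a', c'⟩ h
    simp only [Prod.mk.injEq, neg_inj] at h
    exact Prod.ext h.2 h.1
  have hbox : (Set.Icc (-n) n ×ˢ Set.Icc (-n) n).Finite :=
    (Set.finite_Icc _ _).prod (Set.finite_Icc _ _)
  have hf1 := finite_pairsAbove hn Q T
  have hf2 := (finite_pairsAbove hn (-Q) T).image fun x : ℤ × ℤ => (-x.2, -x.1)
  have hdisj : Disjoint (pairsAbove n Q T)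
      ((fun x : ℤ × ℤ => (-x.2, -x.1)) '' pairsAbove n (-Q) T) := by
    rw [Set.disjoint_left]
    rintro _ h1 ⟨x, h2, rfl⟩
    have h3 := snd_pos_of_mem_pairsAbove hn h2
    have h4 := h1.1
    simp only at h4
    omega
  have hlow : pairsAbove n Q T ∪ (fun x : ℤ × ℤ => (-x.2, -x.1)) '' pairsAbove n (-Q) T ⊆
      {ac : ℤ × ℤ | ac.2 < ac.1 ∧ ac.1 ≠ 0 ∧ ac.2 ≠ 0 ∧ |(ac.1 : ℝ)| ≤ T ∧ |(ac.2 : ℝ)| ≤ T ∧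
        ∃ b : ℤ, 0 ≤ b ∧ b ^ 2 = ac.1 * ac.2 + n ∧ ProperEquiv (ac.1, 2 * b, ac.2) Q} := by
    have habs : ∀ {R : ℤ × ℤ × ℤ} {ac : ℤ × ℤ}, ac ∈ pairsAbove n R T →
        |(ac.1 : ℝ)| ≤ T ∧ |(ac.2 : ℝ)| ≤ T := by
      intro R ac h
      have h0 := snd_pos_of_mem_pairsAbove hn h
      have h1 : (0 : ℝ) < ac.2 := by exact_mod_cast h0
      have h2 : (ac.2 : ℝ) < ac.1 := by exact_mod_cast h.2.2.1
      rw [abs_of_pos h1, abs_of_pos (h1.trans h2)]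
      exact ⟨h.2.1, h2.le.trans h.2.1⟩
    rintro ac (h | ⟨x, h, rfl⟩)
    · obtain ⟨e1, e2⟩ := habs h
      obtain ⟨h1, -, h3, h4, h5⟩ := h
      exact ⟨h3, by omega, h4, e1, e2, h5⟩
    · obtain ⟨e1, e2⟩ := habs h
      obtain ⟨h1, -, h3, h4, b, hb0, hb, he⟩ := h
      refine ⟨by simpa using h3, by simpa using h4, by simp only; omega, by simpa using e2,
        by simpa using e1, b, hb0, by simp only; rw [hb]; ring, ?_⟩
      simpa using he.neg_swap
  have hup : {ac : ℤ × ℤ | ac.2 < ac.1 ∧ ac.1 ≠ 0 ∧ ac.2 ≠ 0 ∧ |(ac.1 : ℝ)| ≤ T ∧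
        |(ac.2 : ℝ)| ≤ T ∧ ∃ b : ℤ, 0 ≤ b ∧ b ^ 2 = ac.1 * ac.2 + n ∧
        ProperEquiv (ac.1, 2 * b, ac.2) Q} ⊆
      (pairsAbove n Q T ∪ (fun x : ℤ × ℤ => (-x.2, -x.1)) '' pairsAbove n (-Q) T) ∪
        Set.Icc (-n) n ×ˢ Set.Icc (-n) n := by
    rintro ⟨a, c⟩ ⟨h1, h2, h3, h4, h5, b, hb0, hb, he⟩
    simp only at h1 h2 h3 h4 h5 hb he
    rcases lt_or_ge n a with h6 | h6
    · exact Or.inl (Or.inl ⟨h6, (abs_le.1 h4).2, h1, h3, b, hb0, hb, he⟩)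
    rcases lt_or_ge c (-n) with h7 | h7
    · refine Or.inl (Or.inr ⟨(-c, -a), ⟨by simp only; omega, ?_, by simp only; omega,
        by simp only; omega, b, hb0, by simp only; rw [hb]; ring, he.neg_swap⟩, by simp⟩)
      push_cast
      linarith [(abs_le.1 h5).1]
    · exact Or.inr ⟨⟨by simp only; omega, h6⟩, ⟨h7, by simp only; omega⟩⟩
  have hcard : (pairsAbove n Q T ∪
      (fun x : ℤ × ℤ => (-x.2, -x.1)) '' pairsAbove n (-Q) T).ncard =
      (pairsAbove n Q T).ncard + (pairsAbove n (-Q) T).ncard := by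
    rw [Set.ncard_union_eq hdisj hf1 hf2, Set.ncard_image_of_injective _ hinj]
  have hfin := (hf1.union hf2).union hbox
  rw [← hcard, DTQ]
  exact ⟨Set.ncard_le_ncard hlow (hfin.subset hup),
    (Set.ncard_le_ncard hup hfin).trans (Set.ncard_union_le _ _)⟩

lemma IsScaledForm.neg (h : IsScaledForm A B C k D) : IsScaledForm (-A) (-B) (-C) k D := by
  obtain ⟨x, y, z, hb⟩ := h.bezout
  exact ⟨h.scale_pos, neg_ne_zero.2 h.fst_ne, ⟨-x, -y, -z, by linarith⟩,
    by rw [h.disc]; ring, h.disc_pos⟩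

lemma tendsto_dtq_div (h : IsScaledForm A B C k D) (hp : IsMinimalPell D t₀ s₀)
    (hn : 0 < n) (hns : ¬∃ m : ℤ, n = m ^ 2) (hkD : D * k ^ 2 = 4 * n) :
    Tendsto (fun T : ℝ => (DTQ n (k * A, k * B, k * C) T : ℝ) / T) atTop
      (nhds (6 * log (pellUnit D t₀ s₀) / (π ^ 2 * √(n : ℝ)))) := by
  have hk : (0 : ℝ) < k := by exact_mod_cast h.scale_pos
  have hroot : √(n : ℝ) = k * √(D : ℝ) / 2 := by
    have e : (n : ℝ) = (k * √(D : ℝ) / 2) ^ 2 := by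
      have h1 : (D : ℝ) * k ^ 2 = 4 * n := by exact_mod_cast hkD
      have h2 := Real.sq_sqrt (by exact_mod_cast h.disc_pos.le : (0 : ℝ) ≤ D)
      linear_combination -h1 / 4 - (k : ℝ) ^ 2 / 4 * h2
    rw [e, Real.sqrt_sq h.root_pos.le]
  have hneg : (k * -A, k * -B, k * -C) = -(k * A, k * B, k * C) := by simp
  have t1 := tendsto_ncard_pairsAbove h hp hn hns hkD
  have t2 := tendsto_ncard_pairsAbove h.neg hp hn hns hkD
  rw [hneg] at t2
  have t3 := t1.add t2
  have t4 := t3.add (tendsto_const_nhds.div_atTop tendsto_id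
    (a := ((Set.Icc (-n) n ×ˢ Set.Icc (-n) n).ncard : ℝ)))
  have hval : 6 / π ^ 2 * (log (pellUnit D t₀ s₀) / (2 * (k * √(D : ℝ) / 2))) +
      6 / π ^ 2 * (log (pellUnit D t₀ s₀) / (2 * (k * √(D : ℝ) / 2))) =
      6 * log (pellUnit D t₀ s₀) / (π ^ 2 * √(n : ℝ)) := by
    rw [← hroot]
    have : √(n : ℝ) ≠ 0 := by rw [hroot]; exact h.root_pos.ne'
    field_simp
    ring
  rw [add_zero] at t4
  rw [hval] at t3 t4
  refine tendsto_of_tendsto_of_tendsto_of_le_of_le' t3 t4 ?_ ?_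
  · filter_upwards [eventually_gt_atTop 0] with T hT
    rw [← add_div]
    gcongr
    exact_mod_cast (dtq_bounds hn _ T).1
  · filter_upwards [eventually_gt_atTop 0] with T hT
    rw [id, ← add_div, ← add_div]
    gcongr
    exact_mod_cast (dtq_bounds hn _ T).2

end Counting

/-- **Theorem 1 (b).** For a positive nonsquare integer `n` and an integral binary
quadratic form `Q = [a,b,c]` of discriminant `4n` and content `k` (so `d' = 4n/k²` is a
positive nonsquare discriminant), letting `(t₀, s₀)` be the minimal positive solution of
the Pell-type equation `t² - d' s² = 4` and `λ_{d'} = (t₀ + s₀ √d')/2`, as `T → ∞` one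
has `D_T^Q = 6 T log(λ_{d'}) / (π² n^{1/2}) + o(T)`. -/
theorem equidistribution_indefinite_nonsplit (n : ℤ) (hn : 0 < n)
    (hns : ¬∃ m : ℤ, n = m ^ 2) (a b c : ℤ) (k : ℕ) (d' : ℤ)
    (hdisc : b ^ 2 - 4 * a * c = 4 * n)
    (hcontent : Int.gcd a (Int.gcd b c) = k)
    (hd' : 4 * n = d' * (k : ℤ) ^ 2)
    (t₀ s₀ : ℤ) (ht₀ : 0 < t₀) (hs₀ : 0 < s₀)
    (hpell : t₀ ^ 2 - d' * s₀ ^ 2 = 4)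
    (hmin : ∀ t s : ℤ, 0 < t → 0 < s → t ^ 2 - d' * s ^ 2 = 4 → t₀ ≤ t) :
    (fun T : ℝ => (DTQ n (a, b, c) T : ℝ) -
        6 * T * Real.log (((t₀ : ℝ) + (s₀ : ℝ) * Real.sqrt (d' : ℝ)) / 2) /
          (Real.pi ^ 2 * Real.sqrt (n : ℝ)))
      =o[atTop] (fun T : ℝ => T) := by

  have hk0 : k ≠ 0 := by
    rintro rfl
    simp at hd'
    omega
  have hkpos : (0 : ℤ) < k := by exact_mod_cast Nat.pos_of_ne_zero hk0
  have hg : (k : ℤ) ∣ a ∧ (k : ℤ) ∣ b ∧ (k : ℤ) ∣ c := by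
    have h1 : (k : ℤ) ∣ (Int.gcd b c : ℤ) := hcontent ▸ Int.gcd_dvd_right ..
    exact ⟨hcontent ▸ Int.gcd_dvd_left .., h1.trans (Int.gcd_dvd_left ..),
      h1.trans (Int.gcd_dvd_right ..)⟩
  have hbez : ∃ x y z : ℤ, a * x + b * y + c * z = k := by
    have h1 := Int.gcd_eq_gcd_ab a (Int.gcd b c)
    have h2 := Int.gcd_eq_gcd_ab b c
    rw [hcontent] at h1
    refine ⟨a.gcdA (b.gcd c), b.gcdA c * a.gcdB (b.gcd c), b.gcdB c * a.gcdB (b.gcd c), ?_⟩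
    rw [h1]
    linear_combination (-a.gcdB (b.gcd c)) * h2
  obtain ⟨⟨A, rfl⟩, ⟨B, rfl⟩, ⟨C, rfl⟩⟩ := hg
  obtain ⟨x, y, z, hxyz⟩ := hbez
  have hdp : 0 < d' := by
    refine pos_of_mul_pos_left (?_ : 0 < d' * (k : ℤ) ^ 2) (by positivity)
    omega
  have hform : IsScaledForm A B C k d' := by
    refine ⟨hkpos, ?_, ⟨x, y, z, mul_left_cancel₀ hkpos.ne' (by linear_combination hxyz)⟩,
      mul_right_cancel₀ (pow_ne_zero 2 hkpos.ne') (by linear_combination -hd' - hdisc), hdp⟩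
    rintro rfl
    have hev : Even ((k * B : ℤ) ^ 2) := ⟨2 * n, by linear_combination hdisc⟩
    obtain ⟨m, hm⟩ := (Int.even_pow.1 hev).1
    rw [hm] at hdisc
    exact hns ⟨m, by linarith⟩
  have hlim := tendsto_dtq_div hform ⟨hdp, ht₀, hs₀, hpell, hmin⟩ hn hns hd'.symm
  rw [isLittleO_iff_tendsto' (by
    filter_upwards [eventually_gt_atTop 0] with T hT h0
    exact absurd h0 hT.ne')]
  have hsub := hlim.sub_const (6 * log (pellUnit d' t₀ s₀) / (π ^ 2 * √(n : ℝ)))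
  rw [sub_self] at hsub
  refine hsub.congr' ?_
  filter_upwards [eventually_gt_atTop 0] with T hT
  rw [pellUnit]
  field_simp
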